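/- arXiv:2412.20900 — 2 statements merged into one kernel-verified Lean document; each statement's English description precedes it below -/
import Mathlib

section
/- Let X be a real Banach space such that for every closed subspace M of X there exist a net G in the quotient space X/M and a Lipschitz map ψ : G → X with φ(ψ(u)) = u for all u ∈ G, where φ : X → X/M is the quotient map. Then X is isomorphic to a Hilbert space. -/
open scoped NNReal

universe u

variable (X : Type u) [NormedAddCommGroup X] [NormedSpace ℝ X]

/-- `f` is a real inner product on `X`: symmetric, bilinear, positive definite. -/
def IsRealInner (f : X → X → ℝ) : Prop :=
  (∀ x y, f x y = f y x) ∧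
  (∀ (a : ℝ) (x y : X), f (a • x) y = a * f x y) ∧
  (∀ x y z : X, f (x + y) z = f x z + f y z) ∧
  (∀ x : X, x ≠ 0 → 0 < f x x)

/-- `X` is isomorphic to a Hilbert space: there is a real inner product on `X` whose
induced norm is equivalent to the given norm. -/
def IsomorphicToHilbert : Prop :=
  ∃ f : X → X → ℝ, IsRealInner X f ∧
    ∃ a b : ℝ, 0 < a ∧ 0 < b ∧ ∀ x : X, a * ‖x‖ ^ 2 ≤ f x x ∧ f x x ≤ b * ‖x‖ ^ 2

/-- `G` is a net in the metric space `M`: its points are `a`-separated and every point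
of `M` is within distance `b` of `G`, for some `a, b > 0`. -/
def IsNet {M : Type*} [MetricSpace M] (G : Set M) : Prop :=
  ∃ a b : ℝ, 0 < a ∧ 0 < b ∧
    (∀ x ∈ G, ∀ y ∈ G, x ≠ y → a ≤ dist x y) ∧
    ∀ x : M, ∃ y ∈ G, dist x y ≤ b

open Filter Topology

/-- `P` maps `Z` into `E` with seminorm bound `c` on `Z`, and fixes `E` pointwise. -/
def IsProjOn {V : Type*} [AddCommGroup V] [Module ℝ V] (p : Seminorm ℝ V) (P : V →ₗ[ℝ] V)
    (E Z : Submodule ℝ V) (c : ℝ) : Prop :=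
  (∀ z ∈ Z, P z ∈ E ∧ p (P z) ≤ c * p z) ∧ ∀ e ∈ E, P e = e

/-- Every finite-dimensional subspace is `c`-complemented in every larger finite-dimensional
subspace. -/
def UniformlyComplemented {V : Type*} [AddCommGroup V] [Module ℝ V] (p : Seminorm ℝ V)
    (c : ℝ) : Prop :=
  ∀ E Z : Submodule ℝ V, E.FG → Z.FG → E ≤ Z → ∃ P : V →ₗ[ℝ] V, IsProjOn p P E Z c

section Complementation

variable {V : Type*} [AddCommGroup V] [Module ℝ V] {p : Seminorm ℝ V}

lemma IsProjOn.trans {P Q : V →ₗ[ℝ] V} {E F Z : Submodule ℝ V} {a b : ℝ} (hb : 0 ≤ b)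
    (hFE : F ≤ E) (hP : IsProjOn p P F Z a)
    (hQ : IsProjOn p Q (E ⊓ LinearMap.ker P) ⊤ b) (hEZ : E ≤ Z) :
    IsProjOn p (P + Q ∘ₗ (LinearMap.id - P)) E Z (a + b * (1 + a)) := by
  refine ⟨fun z hz => ⟨?_, ?_⟩, fun e he => ?_⟩
  · exact E.add_mem (hFE (hP.1 z hz).1) (hQ.1 _ trivial).1.1
  · have h1 := (hP.1 z hz).2
    have h2 := (hQ.1 (z - P z) trivial).2
    have h3 : p (z - P z) ≤ p z + p (P z) := map_sub_le_add p _ _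
    have h4 : p (P z + Q (z - P z)) ≤ p (P z) + p (Q (z - P z)) := map_add_le_add p _ _
    have h5 : b * p (z - P z) ≤ b * (p z + a * p z) := by gcongr; linarith
    simp only [LinearMap.add_apply, LinearMap.comp_apply, LinearMap.sub_apply, LinearMap.id_apply]
    linarith
  · have hPe := (hP.1 e (hEZ he)).1
    have : Q (e - P e) = e - P e := by
      refine hQ.2 _ ⟨E.sub_mem he (hFE hPe), ?_⟩
      simp [hP.2 _ hPe]
    simp [this]

end Complementation

section NormedComplementation

variable {Y : Type*} [NormedAddCommGroup Y] [NormedSpace ℝ Y]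

lemma exists_isProjOn_finrank (k : ℕ) : ∃ c : ℝ, 0 ≤ c ∧ ∀ E : Submodule ℝ Y, E.FG →
    Module.finrank ℝ E ≤ k → ∃ P : Y →ₗ[ℝ] Y, IsProjOn (normSeminorm ℝ Y) P E ⊤ c := by
  induction k with
  | zero =>
    refine ⟨0, le_rfl, fun E hE hk => ⟨0, fun z _ => by simp, fun e he => ?_⟩⟩
    have : FiniteDimensional ℝ E := Module.Finite.iff_fg.2 hE
    have hb : E = ⊥ := Submodule.finrank_eq_zero.1 (Nat.le_zero.1 hk)
    subst hb
    simpa using he.symm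
  | succ k ih =>
    obtain ⟨c, hc, h⟩ := ih
    refine ⟨1 + c * (1 + 1), by positivity, fun E hE hk => ?_⟩
    have : FiniteDimensional ℝ E := Module.Finite.iff_fg.2 hE
    by_cases hb : E = ⊥
    · subst hb
      exact ⟨0, fun z _ => by simp; positivity, fun e he => by simpa using he.symm⟩
    obtain ⟨e, he, he0⟩ := E.ne_bot_iff.1 hb
    obtain ⟨g, hg, hge⟩ := exists_dual_vector ℝ e (norm_ne_zero_iff.2 he0)
    have hge' : g e = ‖e‖ := hge
    have hne : ‖e‖ ≠ 0 := norm_ne_zero_iff.2 he0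
    let P : Y →ₗ[ℝ] Y := (g : Y →ₗ[ℝ] ℝ).smulRight (‖e‖⁻¹ • e)
    have hPapp : ∀ y, P y = g y • ‖e‖⁻¹ • e := fun y => rfl
    have hP : IsProjOn (normSeminorm ℝ Y) P (ℝ ∙ e) ⊤ 1 := by
      refine ⟨fun z _ => ⟨?_, ?_⟩, fun x hx => ?_⟩
      · exact Submodule.smul_mem _ _ (Submodule.smul_mem _ _ (Submodule.mem_span_singleton_self e))
      · have : ‖g z‖ ≤ ‖z‖ := by simpa [hg] using g.le_opNorm z
        rw [hPapp]
        simp only [coe_normSeminorm, norm_smul, norm_inv, norm_norm]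
        rw [inv_mul_cancel₀ hne]
        linarith
      · obtain ⟨a, rfl⟩ := Submodule.mem_span_singleton.1 hx
        rw [hPapp, map_smul, hge', smul_eq_mul, smul_smul, mul_assoc, mul_inv_cancel₀ hne, mul_one]
    have hlt : E ⊓ LinearMap.ker P < E := by
      refine lt_of_le_of_ne inf_le_left fun heq => ?_
      have h1 : e ∈ LinearMap.ker P := (heq.ge he).2
      have h2 : P e = e := hP.2 e (Submodule.mem_span_singleton_self e)
      rw [LinearMap.mem_ker, h2] at h1
      exact he0 h1
    have hfin : FiniteDimensional ℝ (E ⊓ LinearMap.ker P : Submodule ℝ Y) :=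
      Submodule.finiteDimensional_of_le inf_le_left
    obtain ⟨Q, hQ⟩ := h (E ⊓ LinearMap.ker P) (Module.Finite.iff_fg.1 hfin)
      (Nat.lt_succ_iff.1 (lt_of_lt_of_le (Submodule.finrank_lt_finrank_of_lt hlt) hk))
    have hspan : (ℝ ∙ e) ≤ E := by simpa using he
    exact ⟨_, hP.trans hc hspan hQ le_top⟩

/-- If all finite-dimensional subspaces of a finite-codimensional subspace are uniformly
complemented, then so are all finite-dimensional subspaces. -/
lemma uniformlyComplemented_of_coFG {N : Submodule ℝ Y} (hN : N.CoFG) {a : ℝ}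
    (h : ∀ E Z : Submodule ℝ Y, E.FG → Z.FG → E ≤ Z → E ≤ N →
      ∃ P : Y →ₗ[ℝ] Y, IsProjOn (normSeminorm ℝ Y) P E Z a) :
    ∃ c, UniformlyComplemented (normSeminorm ℝ Y) c := by
  have : FiniteDimensional ℝ (Y ⧸ N) := hN
  obtain ⟨b, hb, hk⟩ := exists_isProjOn_finrank (Y := Y) (Module.finrank ℝ (Y ⧸ N))
  refine ⟨a + b * (1 + a), fun E Z hE hZ hEZ => ?_⟩
  have hEf : FiniteDimensional ℝ E := Module.Finite.iff_fg.2 hE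
  have hF : FiniteDimensional ℝ (E ⊓ N : Submodule ℝ Y) :=
    Submodule.finiteDimensional_of_le inf_le_left
  obtain ⟨P, hP⟩ := h (E ⊓ N) Z (Module.Finite.iff_fg.1 hF) hZ (inf_le_left.trans hEZ) inf_le_right
  have hK : FiniteDimensional ℝ (E ⊓ LinearMap.ker P : Submodule ℝ Y) :=
    Submodule.finiteDimensional_of_le inf_le_left
  have hrank : Module.finrank ℝ (E ⊓ LinearMap.ker P : Submodule ℝ Y) ≤
      Module.finrank ℝ (Y ⧸ N) := by
    refine LinearMap.finrank_le_finrank_of_injective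
      (f := N.mkQ ∘ₗ (E ⊓ LinearMap.ker P).subtype) ?_
    rw [← LinearMap.ker_eq_bot, LinearMap.ker_eq_bot']
    rintro ⟨x, hxE, hxP⟩ hx
    have hxN : x ∈ N := by simpa using hx
    have := hP.2 x ⟨hxE, hxN⟩
    rw [LinearMap.mem_ker.1 hxP] at this
    exact Subtype.ext this.symm
  obtain ⟨Q, hQ⟩ := hk _ (Module.Finite.iff_fg.1 hK) hrank
  exact ⟨_, hP.trans hb inf_le_left hQ hEZ⟩

/-- A finite-dimensional subspace is normed, up to a factor `2`, by finitely many functionals. -/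
lemma exists_coFG_norm_le (F : Submodule ℝ Y) (hF : F.FG) : ∃ N : Submodule ℝ Y, N.CoFG ∧
    ∀ f ∈ F, ∀ z ∈ N, ‖f‖ ≤ 2 * ‖f + z‖ := by
  have : FiniteDimensional ℝ F := Module.Finite.iff_fg.2 hF
  have : ProperSpace F := FiniteDimensional.proper ℝ F
  obtain ⟨t, ht, hcov⟩ := Metric.totallyBounded_iff.1
    (isCompact_sphere (0 : F) 1).totallyBounded (1 / 4) (by norm_num)
  have hex : ∀ x : Y, ∃ g : Y →L[ℝ] ℝ, ‖g‖ ≤ 1 ∧ g x = ‖x‖ := fun x => by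
    obtain ⟨g, hg, hx⟩ := exists_dual_vector'' ℝ x
    exact ⟨g, hg, hx⟩
  choose g hg hgx using hex
  refine ⟨sInf ((fun x : F => LinearMap.ker (g x : Y →ₗ[ℝ] ℝ)) '' t), ?_, fun f hf z hz => ?_⟩
  · refine Submodule.CoFG.sInf_of_finite (ht.image _) ?_
    rintro _ ⟨x, -, rfl⟩
    exact Submodule.CoFG.ker _
  · by_cases hf0 : f = 0
    · simp [hf0]
    have hfn : 0 < ‖f‖ := norm_pos_iff.2 hf0
    have hmem : (⟨‖f‖⁻¹ • f, F.smul_mem _ hf⟩ : F) ∈ Metric.sphere (0 : F) 1 := by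
      simp [norm_smul, hfn.ne']
    obtain ⟨x, hxt, hx⟩ := Set.mem_iUnion₂.1 (hcov hmem)
    have hzx : g x z = 0 := by
      rw [Submodule.mem_sInf] at hz
      exact LinearMap.mem_ker.1 (hz _ ⟨x, hxt, rfl⟩)
    have hd : ‖‖f‖⁻¹ • f - (x : Y)‖ < 1 / 4 := by
      simpa [dist_eq_norm] using hx
    have h1 : ‖f‖⁻¹ * g x f = g x x + g x (‖f‖⁻¹ • f - x) := by simp
    have h2 : |g x (‖f‖⁻¹ • f - x)| ≤ 1 * ‖‖f‖⁻¹ • f - (x : Y)‖ :=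
      (g x).le_of_opNorm_le (hg x) _
    have h3 : ‖‖f‖⁻¹ • f‖ ≤ ‖(x : Y)‖ + ‖‖f‖⁻¹ • f - (x : Y)‖ := norm_le_insert' _ _
    have h3' : ‖‖f‖⁻¹ • f‖ = 1 := by simp [norm_smul, hfn.ne']
    have h4 : |g x (f + z)| ≤ 1 * ‖f + z‖ := (g x).le_of_opNorm_le (hg x) _
    rw [map_add, hzx, add_zero] at h4
    have h5 : g x (x : Y) = ‖(x : Y)‖ := hgx x
    have h6 := neg_le_of_abs_le h2
    have h7 : 1 / 2 ≤ ‖f‖⁻¹ * g x f := by linarith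
    rw [inv_mul_eq_div, le_div_iff₀ hfn] at h7
    linarith [le_abs_self (g x f)]

end NormedComplementation

section Lifting

variable {Y : Type*} [NormedAddCommGroup Y] [NormedSpace ℝ Y]

lemma exists_tendsto_ultrafilter {ι F : Type*} [PseudoMetricSpace F] [ProperSpace F]
    (U : Ultrafilter ι) (f : ι → F) (x : F) (r : ℝ) (hf : ∀ i, dist (f i) x ≤ r) :
    ∃ y, Tendsto f U (𝓝 y) := by
  obtain ⟨y, -, hy⟩ := (isCompact_closedBall x r).ultrafilter_le_nhds (U.map f) (by
    rw [le_principal_iff]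
    exact Eventually.of_forall (f := (U : Filter ι)) hf)
  exact ⟨y, hy⟩

/-- A Lipschitz retraction onto a finite-dimensional subspace, equivariant under translations by
that subspace, can be differentiated to give a linear projection. -/
lemma exists_isProjOn_of_lipschitz {E Z : Submodule ℝ Y} (hE : E.FG) (hZ : Z.FG) (hEZ : E ≤ Z)
    {c : ℝ≥0} {R : Y → Y} (hR : LipschitzWith c R) (hRE : ∀ x, R x ∈ E)
    (hadd : ∀ x, ∀ e ∈ E, R (x + e) = R x + e) :
    ∃ P : Y →ₗ[ℝ] Y, IsProjOn (normSeminorm ℝ Y) P E Z c := by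
  have : FiniteDimensional ℝ E := Module.Finite.iff_fg.2 hE
  have : FiniteDimensional ℝ Z := Module.Finite.iff_fg.2 hZ
  let f : Z → E := fun z => ⟨R z, hRE z⟩
  have hf : LipschitzWith c f := fun x y => hR x y
  let _ : MeasurableSpace Z := borel Z
  have : BorelSpace Z := ⟨rfl⟩
  obtain ⟨z, hz⟩ := (hf.ae_differentiableAt (μ := MeasureTheory.Measure.addHaar)).exists
  set D := fderiv ℝ f z with hD
  obtain ⟨P, hP⟩ := LinearMap.exists_extend (E.subtype ∘ₗ (D : Z →ₗ[ℝ] E))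
  have hPz : ∀ w : Z, P w = D w := fun w => LinearMap.congr_fun hP w
  refine ⟨P, fun w hw => ⟨?_, ?_⟩, fun e he => ?_⟩
  · rw [hPz ⟨w, hw⟩]
    exact (D ⟨w, hw⟩).2
  · rw [hPz ⟨w, hw⟩]
    exact D.le_of_opNorm_le (norm_fderiv_le_of_lipschitz ℝ hf) ⟨w, hw⟩
  · rw [hPz ⟨e, hEZ he⟩]
    have h1 : HasDerivAt (fun t : ℝ => f (z + t • ⟨e, hEZ he⟩)) (D ⟨e, hEZ he⟩) 0 :=
      hz.hasFDerivAt.hasLineDerivAt ⟨e, hEZ he⟩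
    have h2 : (fun t : ℝ => f (z + t • ⟨e, hEZ he⟩)) = fun t => f z + t • ⟨e, he⟩ := by
      funext t
      apply Subtype.ext
      exact hadd z (t • e) (E.smul_mem t he)
    have h3 : HasDerivAt (fun t : ℝ => f z + t • (⟨e, he⟩ : E)) ((1 : ℝ) • ⟨e, he⟩) 0 :=
      ((hasDerivAt_id (0 : ℝ)).smul_const _).const_add _
    rw [h2] at h1
    rw [h1.unique h3, one_smul]

/-- A Lipschitz lifting of a net yields, on each dense subspace of the kernel, asymptotically
Lipschitz and asymptotically equivariant maps. -/
lemma exists_asymptotic_retraction (M : Submodule ℝ Y) [IsClosed (M : Set Y)] {M₀ : Submodule ℝ Y}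
    (hM : M = M₀.topologicalClosure) {G : Set (Y ⧸ M)} (hG : IsNet G) {K : ℝ≥0} {ψ : G → Y}
    (hψ : LipschitzWith K ψ) (hlift : ∀ u : G, Submodule.Quotient.mk (ψ u) = (u : Y ⧸ M)) :
    ∃ (b : ℝ) (ρ : ℕ → Y → Y), (∀ n x, ρ n x ∈ M₀) ∧
      (∀ n x y, ‖ρ n x - ρ n y‖ ≤ (1 + K) * ‖x - y‖ + b / (n + 1)) ∧
      ∀ n x, ∀ m ∈ M₀, ‖ρ n (x + m) - ρ n x - m‖ ≤ b / (n + 1) := by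
  obtain ⟨-, b, -, hb, -, hnet⟩ := hG
  choose g hgG hg using hnet
  let F : ℕ → Y → Y := fun n x =>
    ((n : ℝ) + 1)⁻¹ • ψ ⟨g (((n : ℝ) + 1) • M.mkQ x), hgG _⟩
  have hn0 : ∀ n : ℕ, (0 : ℝ) < n + 1 := fun n => by positivity
  have hnear : ∀ n x, ∃ m ∈ M₀, ‖m - (x - F n x)‖ ≤ 3 * b / (n + 1) := by
    intro n x
    have h1 : ‖(M.mkQ (x - F n x) : Y ⧸ M)‖ ≤ b / (n + 1) := by
      have h2 : M.mkQ (F n x) = ((n : ℝ) + 1)⁻¹ • g (((n : ℝ) + 1) • M.mkQ x) := by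
        simp only [F, map_smul]
        congr 1
        exact hlift _
      have h3 : M.mkQ (x - F n x) =
          ((n : ℝ) + 1)⁻¹ • (((n : ℝ) + 1) • M.mkQ x - g (((n : ℝ) + 1) • M.mkQ x)) := by
        rw [map_sub, h2, smul_sub, smul_smul, inv_mul_cancel₀ (hn0 n).ne', one_smul]
      rw [h3, norm_smul, norm_inv, Real.norm_of_nonneg (hn0 n).le, inv_mul_eq_div]
      gcongr
      rw [← dist_eq_norm]
      exact hg _
    obtain ⟨y, hy, hyn⟩ := Submodule.Quotient.norm_mk_lt (M.mkQ (x - F n x))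
      (div_pos hb (hn0 n))
    have hyM : (x - F n x) - y ∈ M := (Submodule.Quotient.eq M).1 hy.symm
    rw [hM] at hyM
    obtain ⟨m, hm, hmd⟩ := Metric.mem_closure_iff.1 hyM (b / (n + 1)) (div_pos hb (hn0 n))
    refine ⟨m, hm, ?_⟩
    rw [dist_eq_norm] at hmd
    have h4 : m - (x - F n x) = -((x - F n x) - y - m) - y := by abel
    rw [h4]
    refine (norm_sub_le _ _).trans ?_
    rw [norm_neg]
    have : 3 * b / ((n : ℝ) + 1) = b / (n + 1) + (b / (n + 1) + b / (n + 1)) := by ring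
    linarith
  choose ρ hρ hρn using hnear
  refine ⟨6 * b + 2 * K * b, ρ, hρ, fun n x y => ?_, fun n x m hm => ?_⟩
  · have h1 : ‖F n x - F n y‖ ≤ K * ‖x - y‖ + 2 * K * b / (n + 1) := by
      have h2 := hψ.dist_le_mul ⟨g (((n : ℝ) + 1) • M.mkQ x), hgG _⟩
        ⟨g (((n : ℝ) + 1) • M.mkQ y), hgG _⟩
      have h3 : dist (g (((n : ℝ) + 1) • M.mkQ x)) (g (((n : ℝ) + 1) • M.mkQ y)) ≤
          b + (n + 1) * ‖x - y‖ + b := by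
        have h0 := dist_triangle4 (g (((n : ℝ) + 1) • M.mkQ x)) (((n : ℝ) + 1) • M.mkQ x)
          (((n : ℝ) + 1) • M.mkQ y) (g (((n : ℝ) + 1) • M.mkQ y))
        rw [dist_comm (g (((n : ℝ) + 1) • M.mkQ x)) (((n : ℝ) + 1) • M.mkQ x)] at h0
        have h4 : dist (((n : ℝ) + 1) • M.mkQ x) (((n : ℝ) + 1) • M.mkQ y) ≤
            (n + 1) * ‖x - y‖ := by
          rw [dist_eq_norm, ← smul_sub, ← map_sub, norm_smul, Real.norm_of_nonneg (hn0 n).le]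
          gcongr
          exact Submodule.Quotient.norm_mk_le M (x - y)
        linarith [hg (((n : ℝ) + 1) • M.mkQ x), hg (((n : ℝ) + 1) • M.mkQ y)]
      have h5 : ‖F n x - F n y‖ ≤ ((n : ℝ) + 1)⁻¹ * (K * (b + (n + 1) * ‖x - y‖ + b)) := by
        simp only [F]
        rw [← smul_sub, norm_smul, norm_inv, Real.norm_of_nonneg (hn0 n).le, ← dist_eq_norm]
        gcongr
        refine h2.trans ?_
        gcongr
        exact h3
      refine h5.trans (le_of_eq ?_)
      field_simp [(hn0 n).ne']
      ring
    have h6 : ρ n x - ρ n y =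
        (ρ n x - (x - F n x)) - (ρ n y - (y - F n y)) + ((x - y) - (F n x - F n y)) := by abel
    rw [h6]
    refine (norm_add_le _ _).trans ?_
    have h7 := norm_sub_le (ρ n x - (x - F n x)) (ρ n y - (y - F n y))
    have h8 := norm_sub_le (x - y) (F n x - F n y)
    have h9 : (6 * b + 2 * K * b) / ((n : ℝ) + 1) =
      3 * b / (n + 1) + 3 * b / (n + 1) + 2 * K * b / (n + 1) := by ring
    linarith [hρn n x, hρn n y]
  · have hmM : M.mkQ m = 0 := by
      rw [← LinearMap.mem_ker, Submodule.ker_mkQ, hM]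
      exact M₀.le_topologicalClosure hm
    have hF : F n (x + m) = F n x := by simp only [F, map_add, hmM, add_zero]
    have h6 : ρ n (x + m) - ρ n x - m =
        (ρ n (x + m) - (x + m - F n (x + m))) - (ρ n x - (x - F n x)) := by rw [hF]; abel
    rw [h6]
    refine (norm_sub_le _ _).trans ?_
    have h9 : (6 * b + 2 * K * b) / ((n : ℝ) + 1) =
      3 * b / (n + 1) + 3 * b / (n + 1) + 2 * K * b / (n + 1) := by ring
    have : 0 ≤ 2 * K * b / ((n : ℝ) + 1) := by positivity
    linarith [hρn n x, hρn n (x + m)]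

/-- If the quotient by the closure of `M₀` has a Lipschitz lifting of a net, then projections of
`M₀` onto finite-dimensional subspaces extend with control of the norm. -/
lemma exists_isProjOn_of_lifting {M₀ : Submodule ℝ Y} [IsClosed (M₀.topologicalClosure : Set Y)]
    {G : Set (Y ⧸ M₀.topologicalClosure)} (hG : IsNet G) {K : ℝ≥0} {ψ : G → Y}
    (hψ : LipschitzWith K ψ)
    (hlift : ∀ u : G, Submodule.Quotient.mk (ψ u) = (u : Y ⧸ M₀.topologicalClosure))
    {E Z : Submodule ℝ Y} (hE : E.FG) (hZ : Z.FG) (hEZ : E ≤ Z) (hEM : E ≤ M₀)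
    {p : Y →ₗ[ℝ] Y} {c : ℝ≥0} (hp : IsProjOn (normSeminorm ℝ Y) p E M₀ c) :
    ∃ P : Y →ₗ[ℝ] Y, IsProjOn (normSeminorm ℝ Y) P E Z (c * (1 + K)) := by
  obtain ⟨b, ρ, hρ, hρd, hρe⟩ := exists_asymptotic_retraction _ rfl hG hψ hlift
  have : FiniteDimensional ℝ E := Module.Finite.iff_fg.2 hE
  have : ProperSpace E := FiniteDimensional.proper ℝ E
  have hpn : ∀ m ∈ M₀, ‖p m‖ ≤ c * ‖m‖ := fun m hm => (hp.1 m hm).2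
  let f : Y → ℕ → E := fun x n => ⟨p (ρ n x) - p (ρ n 0),
    E.sub_mem (hp.1 _ (hρ n x)).1 (hp.1 _ (hρ n 0)).1⟩
  have hdist : ∀ x y n, dist (f x n) (f y n) ≤ c * ((1 + K) * ‖x - y‖ + b / (n + 1)) := by
    intro x y n
    rw [Subtype.dist_eq, dist_eq_norm]
    simp only [f, sub_sub_sub_cancel_right]
    rw [← map_sub]
    refine (hpn _ (M₀.sub_mem (hρ n x) (hρ n y))).trans ?_
    gcongr
    exact hρd n x y
  have hb : 0 ≤ b := by
    have := (norm_nonneg _).trans (hρe 0 0 0 M₀.zero_mem)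
    simpa using this
  have hbdd : ∀ x n, dist (f x n) 0 ≤ c * ((1 + K) * ‖x‖ + b) := by
    intro x n
    have h0 : f 0 n = 0 := Subtype.ext (by simp [f])
    have h1 := hdist x 0 n
    rw [h0, sub_zero] at h1
    refine h1.trans ?_
    gcongr
    exact div_le_self hb (by linarith [n.cast_nonneg (α := ℝ)])
  choose R hR using fun x => exists_tendsto_ultrafilter (hyperfilter ℕ) (f x) 0 _ (hbdd x)
  have hzero : Tendsto (fun n : ℕ => b / ((n : ℝ) + 1)) (hyperfilter ℕ) (𝓝 0) := by
    refine Tendsto.mono_left ?_ Nat.hyperfilter_le_atTop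
    exact tendsto_const_div_atTop_nhds_zero_nat b |>.comp (tendsto_add_atTop_nat 1) |>.congr
      (fun n => by simp)
  have hlip : LipschitzWith (c * (1 + K)) (fun x => (R x : Y)) := by
    refine LipschitzWith.of_dist_le_mul fun x y => ?_
    have h1 : Tendsto (fun n => dist (f x n) (f y n)) (hyperfilter ℕ) (𝓝 (dist (R x) (R y))) :=
      (hR x).dist (hR y)
    have h2 := ((hzero.const_add ((1 + (K : ℝ)) * ‖x - y‖)).const_mul (c : ℝ))
    have h3 := le_of_tendsto_of_tendsto' h1 h2 (hdist x y)
    rw [Subtype.dist_eq] at h3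
    push_cast
    rw [dist_eq_norm x y]
    linarith
  have hadd : ∀ x, ∀ e ∈ E, (R (x + e) : Y) = R x + e := by
    intro x e he
    have h1 : Tendsto (fun n => f (x + e) n - f x n - ⟨e, he⟩) (hyperfilter ℕ)
      (𝓝 (R (x + e) - R x - ⟨e, he⟩)) := ((hR (x + e)).sub (hR x)).sub_const _
    have h2 : Tendsto (fun n => f (x + e) n - f x n - ⟨e, he⟩) (hyperfilter ℕ) (𝓝 0) := by
      refine squeeze_zero_norm (fun n => ?_) (by simpa using hzero.const_mul (c : ℝ))
      have h3 : ((f (x + e) n - f x n - ⟨e, he⟩ : E) : Y) = p (ρ n (x + e) - ρ n x - e) := by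
        simp only [f, AddSubgroupClass.coe_sub, map_sub, hp.2 e he]
        abel
      change ‖((f (x + e) n - f x n - ⟨e, he⟩ : E) : Y)‖ ≤ _
      rw [h3]
      refine (hpn _ (M₀.sub_mem (M₀.sub_mem (hρ n _) (hρ n _)) (hEM he))).trans ?_
      gcongr
      exact hρe n x e (hEM he)
    have h3 := congrArg (Subtype.val : E → Y) (tendsto_nhds_unique h1 h2)
    simp only [AddSubgroupClass.coe_sub, ZeroMemClass.coe_zero] at h3
    rw [sub_sub, sub_eq_zero] at h3
    exact h3
  simpa using exists_isProjOn_of_lipschitz hE hZ hEZ hlip (fun x => (R x).2) hadd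

end Lifting

section UniformConstant

variable {Y : Type*} [NormedAddCommGroup Y] [NormedSpace ℝ Y]

lemma exists_projection_of_norm_le {F N : Submodule ℝ Y}
    (h : ∀ f ∈ F, ∀ z ∈ N, ‖f‖ ≤ 2 * ‖f + z‖) :
    ∃ π : Y →ₗ[ℝ] Y, (∀ f ∈ F, π f = f) ∧ (∀ z ∈ N, π z = 0) ∧
      ∀ x ∈ F ⊔ N, ‖π x‖ ≤ 2 * ‖x‖ := by
  have hd : Disjoint F N := by
    rw [Submodule.disjoint_def]
    intro x hx hxN
    simpa using h x hx (-x) (N.neg_mem hxN)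
  obtain ⟨N', hN', hc⟩ := hd.symm.exists_isCompl
  have h1 : ∀ f ∈ F, F.projection N' hc.symm f = f := fun f hf =>
    Submodule.projection_apply_left hc.symm ⟨f, hf⟩
  have h2 : ∀ z ∈ N, F.projection N' hc.symm z = 0 := fun z hz =>
    (Submodule.projection_apply_eq_zero_iff hc.symm).2 (hN' hz)
  refine ⟨F.projection N' hc.symm, h1, h2, fun x hx => ?_⟩
  obtain ⟨f, hf, z, hz, rfl⟩ := Submodule.mem_sup.1 hx
  rw [map_add, h1 f hf, h2 z hz, add_zero]
  exact h f hf z hz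

/-- In a sequence of subspaces that are almost orthogonal to the sums of their predecessors, each
term is well complemented in the sum. -/
lemma exists_isProjOn_iSup {E F N : ℕ → Submodule ℝ Y}
    (hFN : ∀ n, ∀ f ∈ F n, ∀ z ∈ N n, ‖f‖ ≤ 2 * ‖f + z‖)
    (hEF : ∀ i n, i < n → E i ≤ F n) (hEN : ∀ i n, n ≤ i → E i ≤ N n) (k : ℕ) :
    ∃ p : Y →ₗ[ℝ] Y, IsProjOn (normSeminorm ℝ Y) p (E k) (⨆ i, E i) 4 := by
  choose π hπF hπN hπ using fun n => exists_projection_of_norm_le (hFN n)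
  have hsup : ∀ n, (⨆ i, E i) ≤ F n ⊔ N n := fun n => iSup_le fun i => by
    rcases lt_or_ge i n with hi | hi
    · exact (hEF i n hi).trans le_sup_left
    · exact (hEN i n hi).trans le_sup_right
  refine ⟨π (k + 1) - π k, fun x hx => ⟨?_, ?_⟩, fun e he => ?_⟩
  · refine Submodule.iSup_induction E (motive := fun x => (π (k + 1) - π k) x ∈ E k) hx
      (fun i x hx => ?_) (by simp) fun x y hx hy => ?_
    · rw [LinearMap.sub_apply]
      rcases lt_trichotomy i k with hi | rfl | hi
      · rw [hπF _ x (hEF i _ (by omega) hx), hπF _ x (hEF i _ hi hx), sub_self]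
        exact zero_mem _
      · rw [hπF _ x (hEF i _ (by omega) hx), hπN _ x (hEN i _ le_rfl hx), sub_zero]
        exact hx
      · rw [hπN _ x (hEN i _ hi hx), hπN _ x (hEN i _ hi.le hx), sub_self]
        exact zero_mem _
    · rw [map_add]; exact add_mem hx hy
  · have h1 := hπ (k + 1) x (hsup _ hx)
    have h2 := hπ k x (hsup _ hx)
    have h3 := norm_sub_le (π (k + 1) x) (π k x)
    simp only [coe_normSeminorm, LinearMap.sub_apply]
    linarith
  · rw [LinearMap.sub_apply, hπF _ e (hEF k _ (by omega) he), hπN _ e (hEN k _ le_rfl he), sub_zero]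

lemma exists_almost_orthogonal_seq (B : {N : Submodule ℝ Y // N.CoFG} → ℕ → Submodule ℝ Y)
    (hB : ∀ N k, (B N k).FG) (hBN : ∀ N k, B N k ≤ N.1) :
    ∃ (E F N : ℕ → Submodule ℝ Y), (∀ n, ∀ f ∈ F n, ∀ z ∈ N n, ‖f‖ ≤ 2 * ‖f + z‖) ∧
      (∀ i n, i < n → E i ≤ F n) ∧ (∀ i n, n ≤ i → E i ≤ N n) ∧
      ∀ n, ∃ N', E n = B N' n := by
  choose D hD hDF using fun F : {F : Submodule ℝ Y // F.FG} => exists_coFG_norm_le F.1 F.2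
  let next : {N : Submodule ℝ Y // N.CoFG} × {F : Submodule ℝ Y // F.FG} →
      {N : Submodule ℝ Y // N.CoFG} := fun s => ⟨s.1.1 ⊓ D s.2, s.1.2.inf (hD s.2)⟩
  let st : ℕ → {N : Submodule ℝ Y // N.CoFG} × {F : Submodule ℝ Y // F.FG} := fun n =>
    Nat.rec (⟨⊤, Submodule.CoFG.top⟩, ⟨⊥, Submodule.fg_bot⟩)
      (fun n s => (next s, ⟨s.2.1 ⊔ B (next s) n, s.2.2.sup (hB _ _)⟩)) n
  have hst : ∀ n, st (n + 1) =
    (next (st n), ⟨(st n).2.1 ⊔ B (next (st n)) n, (st n).2.2.sup (hB _ _)⟩) := fun n => rfl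
  have hanti : Antitone fun n => (next (st n)).1 := antitone_nat_of_succ_le fun n => by
    change (next (st n)).1 ⊓ D (st (n + 1)).2 ≤ _
    exact inf_le_left
  have hmono : Monotone fun n => (st n).2.1 := monotone_nat_of_le_succ fun n => le_sup_left
  refine ⟨fun n => B (next (st n)) n, fun n => (st n).2.1, fun n => (next (st n)).1,
    fun n f hf z hz => hDF _ f hf z hz.2, fun i n hin => ?_, fun i n hni => ?_,
    fun n => ⟨_, rfl⟩⟩
  · exact le_trans (le_sup_right (a := (st i).2.1)) (hmono (Nat.succ_le_of_lt hin))
  · exact (hBN _ _).trans (hanti hni)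

/-- If all quotient maps have Lipschitz right inverses on nets, then finite-dimensional subspaces
are uniformly complemented. -/
theorem exists_uniformlyComplemented
    (h : ∀ (M : Submodule ℝ Y) [IsClosed (M : Set Y)],
      ∃ G : Set (Y ⧸ M), IsNet G ∧
        ∃ (K : ℝ≥0) (ψ : G → Y), LipschitzWith K ψ ∧
          ∀ u : G, Submodule.Quotient.mk (ψ u) = (u : Y ⧸ M)) :
    ∃ c, UniformlyComplemented (normSeminorm ℝ Y) c := by
  by_contra hcon
  have hbad : ∀ (N : {N : Submodule ℝ Y // N.CoFG}) (k : ℕ), ∃ E Z : Submodule ℝ Y, E.FG ∧ Z.FG ∧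
      E ≤ Z ∧ E ≤ N.1 ∧ ∀ P : Y →ₗ[ℝ] Y, ¬ IsProjOn (normSeminorm ℝ Y) P E Z k := by
    intro N k
    by_contra! hc
    exact hcon (uniformlyComplemented_of_coFG N.2 (a := k)
      fun E Z hE hZ hEZ hEN => hc E Z hE hZ hEZ hEN)
  choose B C hB hC hBC hBN hBP using hbad
  obtain ⟨E, F, N, hFN, hEF, hEN, hEB⟩ := exists_almost_orthogonal_seq B hB hBN
  set M₀ := ⨆ i, E i with hM₀
  have : IsClosed (M₀.topologicalClosure : Set Y) := M₀.isClosed_topologicalClosure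
  obtain ⟨G, hG, K, ψ, hψ, hlift⟩ := h M₀.topologicalClosure
  obtain ⟨k, hk⟩ := exists_nat_ge (4 * (1 + (K : ℝ)))
  obtain ⟨p, hp⟩ := exists_isProjOn_iSup hFN hEF hEN k
  obtain ⟨N', hN'⟩ := hEB k
  have hEk : E k ≤ M₀ := le_iSup E k
  rw [hN'] at hp hEk
  obtain ⟨P, hP⟩ := exists_isProjOn_of_lifting (c := 4) hG hψ hlift (hB N' k) (hC N' k)
    (hBC N' k) hEk (by simpa using hp)
  refine hBP N' k P ⟨fun z hz => ⟨(hP.1 z hz).1, (hP.1 z hz).2.trans ?_⟩, hP.2⟩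
  gcongr
  simpa using hk

end UniformConstant

section FiniteRepresentability

variable {W : Type*} [AddCommGroup W] [Module ℝ W] {Y : Type*} [NormedAddCommGroup Y]
  [NormedSpace ℝ Y]

/-- Approximate isometries on all finite sets give isomorphisms on finite-dimensional
subspaces. -/
lemma exists_linearMap_equivalent {p : Seminorm ℝ W} {V : Submodule ℝ W} (hV : V.FG)
    (hdef : ∀ v ∈ V, p v = 0 → v = 0) {S : Set (W →ₗ[ℝ] Y)}
    (hS : ∀ (s : Finset W) (ε : ℝ), 0 < ε → ∃ J ∈ S, ∀ v ∈ s, |p v - ‖J v‖| < ε) :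
    ∃ J ∈ S, ∀ v ∈ V, p v ≤ 2 * ‖J v‖ ∧ ‖J v‖ ≤ 2 * p v := by
  classical
  have : FiniteDimensional ℝ V := Module.Finite.iff_fg.2 hV
  let _ : Norm V := ⟨fun v => p v⟩
  have core : NormedSpace.Core ℝ V :=
    { norm_nonneg := fun v => apply_nonneg p (v : W)
      norm_smul := fun c v => map_smul_eq_mul p c (v : W)
      norm_triangle := fun v w => map_add_le_add p (v : W) w
      norm_eq_zero_iff := fun v => ⟨fun h => Subtype.ext (hdef v v.2 h), fun h => by
        subst h; exact map_zero p⟩ }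
  let _ : NormedAddCommGroup V := NormedAddCommGroup.ofCore core
  let _ : NormedSpace ℝ V := NormedSpace.ofCore core
  have hnorm : ∀ v : V, ‖v‖ = p v := fun v => rfl
  let b := Module.finBasis ℝ V
  let φ : Fin (Module.finrank ℝ V) → V →L[ℝ] ℝ := fun i => (b.coord i).toContinuousLinearMap
  set C : ℝ := ∑ i, ‖φ i‖ * (p (b i) + 1) with hC
  have hC0 : 0 ≤ C := Finset.sum_nonneg fun i _ =>
    mul_nonneg (norm_nonneg _) (by linarith [apply_nonneg p (b i : W)])
  have : ProperSpace V := FiniteDimensional.proper ℝ V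
  obtain ⟨t, ht, hcov⟩ := Metric.totallyBounded_iff.1
    (isCompact_sphere (0 : V) 1).totallyBounded (1 / (8 * (C + 1))) (by positivity)
  obtain ⟨J, hJS, hJ⟩ := hS ((ht.toFinset.image Subtype.val) ∪ (Finset.univ.image fun i => (b i : W)))
    (1 / 8) (by norm_num)
  have hJt : ∀ w ∈ t, |p w - ‖J w‖| < 1 / 8 := fun w hw => hJ w (by simp [hw])
  have hJb : ∀ i, |p (b i) - ‖J (b i)‖| < 1 / 8 := fun i => hJ (b i) (by simp)
  have hJC : ∀ v : V, ‖J v‖ ≤ C * ‖v‖ := by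
    intro v
    have h1 : (v : W) = ∑ i, φ i v • (b i : W) := by
      have h := congrArg Subtype.val (b.sum_repr v)
      rw [← h, Submodule.coe_sum]
      rfl
    rw [h1, map_sum, hC, Finset.sum_mul]
    refine (norm_sum_le _ _).trans (Finset.sum_le_sum fun i _ => ?_)
    rw [map_smul, norm_smul]
    have h2 := (φ i).le_opNorm v
    have h3 : ‖J (b i)‖ ≤ p (b i) + 1 := by linarith [(abs_lt.1 (hJb i)).1]
    calc ‖φ i v‖ * ‖J (b i)‖ ≤ (‖φ i‖ * ‖v‖) * (p (b i) + 1) := by gcongr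
      _ = _ := by ring
  refine ⟨J, hJS, fun v hv => ?_⟩
  by_cases hv0 : v = 0
  · simp [hv0]
  have hpv : 0 < p v := lt_of_le_of_ne (apply_nonneg p v) fun h => hv0 (hdef v hv h.symm)
  let v' : V := (p v)⁻¹ • ⟨v, hv⟩
  have hv'n : ‖v'‖ = 1 := by
    rw [norm_smul, hnorm, norm_inv, Real.norm_of_nonneg hpv.le, inv_mul_cancel₀ hpv.ne']
  obtain ⟨w, hwt, hw⟩ := Set.mem_iUnion₂.1 (hcov (show v' ∈ Metric.sphere (0 : V) 1 by simpa))
  rw [Metric.mem_ball, dist_eq_norm] at hw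
  have h0 : C * ‖v' - w‖ ≤ 1 / 8 := by
    calc C * ‖v' - w‖ ≤ (C + 1) * (1 / (8 * (C + 1))) := by gcongr; linarith
      _ = 1 / 8 := by field_simp
  have h0' : ‖v' - w‖ ≤ 1 / 8 := hw.le.trans (by
    rw [div_le_div_iff₀ (by positivity) (by norm_num)]; linarith)
  have h1 : ‖J v' - J w‖ ≤ 1 / 8 := by
    rw [← map_sub]
    exact (hJC (v' - w)).trans h0
  have h2 := abs_lt.1 (hJt w hwt)
  have h3 := abs_le.1 ((abs_norm_sub_norm_le v' w).trans h0')
  have h4 := abs_le.1 ((abs_norm_sub_norm_le (J v') (J w)).trans h1)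
  rw [hv'n, hnorm] at h3
  have h5 : ‖J v'‖ = (p v)⁻¹ * ‖J v‖ := by
    change ‖J ((p v)⁻¹ • v)‖ = _
    rw [map_smul, norm_smul, norm_inv, Real.norm_of_nonneg hpv.le]
  have h6 : ‖J v‖ = p v * ‖J v'‖ := by rw [h5, ← mul_assoc, mul_inv_cancel₀ hpv.ne', one_mul]
  rw [h6]
  constructor <;> nlinarith

lemma UniformlyComplemented.of_finitely_representable {p : Seminorm ℝ W} {c : ℝ}
    (hY : UniformlyComplemented (normSeminorm ℝ Y) c) (hc : 0 ≤ c)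
    (hdef : ∀ v, p v = 0 → v = 0)
    (hrep : ∀ V : Submodule ℝ W, V.FG →
      ∃ J : W →ₗ[ℝ] Y, ∀ v ∈ V, p v ≤ 2 * ‖J v‖ ∧ ‖J v‖ ≤ 2 * p v) :
    UniformlyComplemented p (4 * c) := by
  intro E Z hE hZ hEZ
  obtain ⟨J, hJ⟩ := hrep Z hZ
  obtain ⟨P, hP⟩ := hY (E.map J) (Z.map J) (hE.map J) (hZ.map J) (Submodule.map_mono hEZ)
  have hker : LinearMap.ker (J ∘ₗ Z.subtype) = ⊥ := by
    rw [LinearMap.ker_eq_bot']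
    rintro ⟨z, hz⟩ h
    have h1 : J z = 0 := h
    have h2 := (hJ z hz).1
    rw [h1, norm_zero, mul_zero] at h2
    exact Subtype.ext (hdef z (le_antisymm h2 (apply_nonneg p z)))
  obtain ⟨L, hL⟩ := LinearMap.exists_leftInverse_of_injective _ hker
  have hLJ : ∀ z ∈ Z, (L (J z) : W) = z := fun z hz =>
    congrArg Subtype.val (LinearMap.congr_fun hL ⟨z, hz⟩)
  refine ⟨Z.subtype ∘ₗ L ∘ₗ P ∘ₗ J, fun z hz => ?_, fun e he => ?_⟩
  · obtain ⟨⟨e, he, hPe⟩, hle⟩ := hP.1 (J z) (Submodule.mem_map_of_mem hz)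
    have h1 : (Z.subtype ∘ₗ L ∘ₗ P ∘ₗ J) z = e := by
      change (L (P (J z)) : W) = e
      rw [← hPe, hLJ e (hEZ he)]
    rw [h1]
    refine ⟨he, ?_⟩
    have h2 := (hJ e (hEZ he)).1
    rw [hPe] at h2
    have h3 : c * ‖J z‖ ≤ c * (2 * p z) := by gcongr; exact (hJ z hz).2
    simp only [coe_normSeminorm] at hle
    linarith
  · change (L (P (J e)) : W) = e
    rw [hP.2 _ (Submodule.mem_map_of_mem he), hLJ e (hEZ he)]

end FiniteRepresentability

section SpreadingModel

variable {Y : Type*} [NormedAddCommGroup Y] [NormedSpace ℝ Y]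

/-- The iterated limit of `‖y + ∑ i < N, a i • x (n i)‖` along a free ultrafilter. -/
noncomputable def iteratedLimit (x : ℕ → Y) : ℕ → (ℕ →₀ ℝ) → Y → ℝ
  | 0, _, y => ‖y‖
  | N + 1, a, y => limUnder (hyperfilter ℕ : Filter ℕ)
      fun n => iteratedLimit x N a (y + a N • x n)

variable {x : ℕ → Y} {B : ℝ}

lemma iteratedLimit_aux (hx : ∀ n, ‖x n‖ ≤ B) (N : ℕ) (a : ℕ →₀ ℝ) :
    (∀ y, 0 ≤ iteratedLimit x N a y ∧
      iteratedLimit x N a y ≤ ‖y‖ + B * ∑ i ∈ Finset.range N, |a i|) ∧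
    ∀ y, Tendsto (fun n => iteratedLimit x N a (y + a N • x n)) (hyperfilter ℕ)
      (𝓝 (iteratedLimit x (N + 1) a y)) := by
  have key : ∀ N, (∀ y, 0 ≤ iteratedLimit x N a y ∧
      iteratedLimit x N a y ≤ ‖y‖ + B * ∑ i ∈ Finset.range N, |a i|) →
      (∀ y n, iteratedLimit x N a (y + a N • x n) ≤
        ‖y‖ + B * ∑ i ∈ Finset.range (N + 1), |a i|) ∧
      ∀ y, Tendsto (fun n => iteratedLimit x N a (y + a N • x n)) (hyperfilter ℕ)
      (𝓝 (iteratedLimit x (N + 1) a y)) := by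
    intro N h
    have h1 : ∀ y n, iteratedLimit x N a (y + a N • x n) ≤
        ‖y‖ + B * ∑ i ∈ Finset.range (N + 1), |a i| := by
      intro y n
      refine (h _).2.trans ?_
      have h2 : ‖y + a N • x n‖ ≤ ‖y‖ + |a N| * B := by
        refine (norm_add_le _ _).trans ?_
        rw [norm_smul, Real.norm_eq_abs]
        gcongr
        exact hx n
      rw [Finset.sum_range_succ]
      linarith
    refine ⟨h1, fun y => ?_⟩
    refine tendsto_nhds_limUnder (exists_tendsto_ultrafilter (hyperfilter ℕ) _ 0
      (‖y‖ + B * ∑ i ∈ Finset.range (N + 1), |a i|) fun n => ?_)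
    rw [Real.dist_eq, sub_zero, abs_of_nonneg (h _).1]
    exact h1 y n
  have bound : ∀ N, (∀ y, 0 ≤ iteratedLimit x N a y ∧
      iteratedLimit x N a y ≤ ‖y‖ + B * ∑ i ∈ Finset.range N, |a i|) := by
    intro N
    induction N with
    | zero => intro y; simp [iteratedLimit]
    | succ N ih =>
      intro y
      have h1 := (key N ih).2 y
      exact ⟨ge_of_tendsto' h1 fun n => (ih _).1, le_of_tendsto' h1 fun n => (key N ih).1 y n⟩
  exact ⟨bound N, (key N (bound N)).2⟩

lemma iteratedLimit_le (hx : ∀ n, ‖x n‖ ≤ B) (N : ℕ) (a : ℕ →₀ ℝ) (y : Y) :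
    iteratedLimit x N a y ≤ ‖y‖ + B * ∑ i ∈ Finset.range N, |a i| :=
  ((iteratedLimit_aux hx N a).1 y).2

lemma tendsto_iteratedLimit (hx : ∀ n, ‖x n‖ ≤ B) (N : ℕ) (a : ℕ →₀ ℝ) (y : Y) :
    Tendsto (fun n => iteratedLimit x N a (y + a N • x n)) (hyperfilter ℕ)
      (𝓝 (iteratedLimit x (N + 1) a y)) := (iteratedLimit_aux hx N a).2 y

lemma iteratedLimit_add_le (hx : ∀ n, ‖x n‖ ≤ B) (N : ℕ) (a b : ℕ →₀ ℝ) (y z : Y) :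
    iteratedLimit x N (a + b) (y + z) ≤ iteratedLimit x N a y + iteratedLimit x N b z := by
  induction N generalizing y z with
  | zero => exact norm_add_le y z
  | succ N ih =>
    refine le_of_tendsto_of_tendsto' (tendsto_iteratedLimit hx N (a + b) (y + z))
      ((tendsto_iteratedLimit hx N a y).add (tendsto_iteratedLimit hx N b z)) fun n => ?_
    have h : y + z + (a + b) N • x n = (y + a N • x n) + (z + b N • x n) := by
      rw [Finsupp.add_apply, add_smul]; abel
    rw [h]
    exact ih _ _

lemma iteratedLimit_smul (hx : ∀ n, ‖x n‖ ≤ B) (N : ℕ) (c : ℝ) (a : ℕ →₀ ℝ) (y : Y) :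
    iteratedLimit x N (c • a) (c • y) = ‖c‖ * iteratedLimit x N a y := by
  induction N generalizing y with
  | zero => exact norm_smul c y
  | succ N ih =>
    refine tendsto_nhds_unique (tendsto_iteratedLimit hx N (c • a) (c • y))
      (((tendsto_iteratedLimit hx N a y).const_mul ‖c‖).congr fun n => ?_)
    rw [← ih, Finsupp.smul_apply, smul_add, smul_smul, smul_eq_mul]

lemma iteratedLimit_spread (hx : ∀ n, ‖x n‖ ≤ B) {σ : ℕ → ℕ} (hσ : StrictMono σ)
    {a b : ℕ →₀ ℝ} (hab : ∀ i, b (σ i) = a i) (M : ℕ) : ∀ (N : ℕ) (y : Y),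
    (∀ i < N, σ i < M) → (∀ j < M, (∀ i < N, σ i ≠ j) → b j = 0) →
    iteratedLimit x M b y = iteratedLimit x N a y := by
  induction M with
  | zero =>
    intro N y h1 h2
    have : N = 0 := by
      by_contra h
      exact absurd (h1 0 (Nat.pos_of_ne_zero h)) (by omega)
    subst this
    rfl
  | succ M ih =>
    intro N y h1 h2
    by_cases hN : ∃ N', N = N' + 1 ∧ σ N' = M
    · obtain ⟨N', rfl, hM⟩ := hN
      have hbM : b M = a N' := by rw [← hM, hab]
      refine tendsto_nhds_unique (tendsto_iteratedLimit hx M b y)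
        ((tendsto_iteratedLimit hx N' a y).congr fun n => ?_)
      rw [hbM]
      refine (ih N' _ (fun i hi => hM ▸ hσ hi) fun j hj hji => h2 j (by omega) fun i hi => ?_).symm
      rcases Nat.lt_succ_iff_lt_or_eq.1 hi with hi | rfl
      · exact hji i hi
      · omega
    · have h3 : ∀ i < N, σ i < M := by
        intro i hi
        refine lt_of_le_of_ne (Nat.lt_succ_iff.1 (h1 i hi)) fun hiM => hN ⟨i, ?_, hiM⟩
        by_contra hne
        have h4 := h1 (i + 1) (by omega)
        have h5 := hσ (Nat.lt_add_one i)
        omega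
      have hbM : b M = 0 := h2 M (Nat.lt_succ_self M) fun i hi => (h3 i hi).ne
      rw [← ih N y h3 fun j hj => h2 j (by omega)]
      refine tendsto_nhds_unique (tendsto_iteratedLimit hx M b y)
        (tendsto_const_nhds.congr fun n => ?_)
      rw [hbM, zero_smul, add_zero]

lemma iteratedLimit_stable (hx : ∀ n, ‖x n‖ ≤ B) {a : ℕ →₀ ℝ} {N M : ℕ} (hNM : N ≤ M)
    (ha : ∀ j, N ≤ j → a j = 0) (y : Y) : iteratedLimit x M a y = iteratedLimit x N a y :=
  iteratedLimit_spread hx strictMono_id (fun _ => rfl) M N y (fun _ hi => lt_of_lt_of_le hi hNM)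
    fun j _ hj => ha j (by by_contra h; exact hj j (by omega) rfl)

lemma exists_approx_iteratedLimit (hx : ∀ n, ‖x n‖ ≤ B) (N : ℕ) :
    ∀ (s : Finset (Y × (ℕ →₀ ℝ))) (ε : ℝ), 0 < ε → ∃ n : ℕ → ℕ, ∀ v ∈ s,
      |iteratedLimit x N v.2 v.1 - ‖v.1 + ∑ i ∈ Finset.range N, v.2 i • x (n i)‖| < ε := by
  classical
  induction N with
  | zero => intro s ε hε; exact ⟨id, fun v _ => by simpa [iteratedLimit] using hε⟩
  | succ N ih =>
    intro s ε hε
    have h1 : ∀ᶠ m in (hyperfilter ℕ : Filter ℕ), ∀ v ∈ s,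
        |iteratedLimit x N v.2 (v.1 + v.2 N • x m) - iteratedLimit x (N + 1) v.2 v.1| < ε / 2 := by
      rw [Filter.eventually_all_finset]
      intro v _
      exact (Metric.tendsto_nhds.1 (tendsto_iteratedLimit hx N v.2 v.1) (ε / 2) (half_pos hε))
    obtain ⟨m, hm⟩ := h1.exists
    obtain ⟨n, hn⟩ := ih (s.image fun v => (v.1 + v.2 N • x m, v.2)) (ε / 2) (half_pos hε)
    refine ⟨Function.update n N m, fun v hv => ?_⟩
    have h2 := hn _ (Finset.mem_image_of_mem _ hv)
    have h3 := hm v hv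
    have h4 : v.1 + ∑ i ∈ Finset.range (N + 1), v.2 i • x (Function.update n N m i) =
        v.1 + v.2 N • x m + ∑ i ∈ Finset.range N, v.2 i • x (n i) := by
      rw [Finset.sum_range_succ, Function.update_self, add_assoc,
        add_comm (∑ i ∈ Finset.range N, _)]
      congr 2
      refine Finset.sum_congr rfl fun i hi => ?_
      rw [Function.update_of_ne (Finset.mem_range.1 hi).ne]
    rw [h4]
    simp only at h2
    rw [abs_lt] at *
    constructor <;> linarith

/-- A bound for the support of a finitely supported sequence. -/
def supportBound (a : ℕ →₀ ℝ) : ℕ := a.support.sup id + 1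

lemma eq_zero_of_supportBound_le {a : ℕ →₀ ℝ} {j : ℕ} (hj : supportBound a ≤ j) : a j = 0 := by
  by_contra h
  have : id j ≤ a.support.sup id := Finset.le_sup (f := id) (Finsupp.mem_support_iff.2 h)
  simp only [supportBound, id] at hj this
  omega

lemma iteratedLimit_supportBound (hx : ∀ n, ‖x n‖ ≤ B) {a : ℕ →₀ ℝ} {N : ℕ}
    (ha : ∀ j, N ≤ j → a j = 0) (y : Y) :
    iteratedLimit x (supportBound a) a y = iteratedLimit x N a y := by
  rw [← iteratedLimit_stable hx (le_max_left (supportBound a) N)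
      (fun j hj => eq_zero_of_supportBound_le hj) y,
    iteratedLimit_stable hx (le_max_right (supportBound a) N) ha y]

/-- The seminorm of the spreading model over `Y` generated by a bounded sequence. -/
noncomputable def spreadingSeminorm (hx : ∀ n, ‖x n‖ ≤ B) : Seminorm ℝ (Y × (ℕ →₀ ℝ)) :=
  Seminorm.of (fun v : Y × (ℕ →₀ ℝ) => iteratedLimit x (supportBound v.2) v.2 v.1)
    (fun v w : Y × (ℕ →₀ ℝ) => by
      let N := max (supportBound v.2) (supportBound w.2)
      have hv : ∀ j, N ≤ j → v.2 j = 0 := fun j hj =>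
        eq_zero_of_supportBound_le ((le_max_left _ _).trans hj)
      have hw : ∀ j, N ≤ j → w.2 j = 0 := fun j hj =>
        eq_zero_of_supportBound_le ((le_max_right _ _).trans hj)
      rw [iteratedLimit_supportBound hx hv, iteratedLimit_supportBound hx hw,
        iteratedLimit_supportBound hx (N := N) fun j hj => by simp [hv j hj, hw j hj]]
      exact iteratedLimit_add_le hx N _ _ _ _)
    (fun (c : ℝ) (v : Y × (ℕ →₀ ℝ)) => by
      rw [iteratedLimit_supportBound hx (N := supportBound v.2)
        fun j hj => by simp [eq_zero_of_supportBound_le hj]]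
      exact iteratedLimit_smul hx _ c _ _)

lemma spreadingSeminorm_eq (hx : ∀ n, ‖x n‖ ≤ B) {v : Y × (ℕ →₀ ℝ)} {N : ℕ}
    (hv : ∀ j, N ≤ j → v.2 j = 0) : spreadingSeminorm hx v = iteratedLimit x N v.2 v.1 :=
  iteratedLimit_supportBound hx hv _

lemma spreadingSeminorm_mapDomain (hx : ∀ n, ‖x n‖ ≤ B) {σ : ℕ → ℕ} (hσ : StrictMono σ) (y : Y)
    (a : ℕ →₀ ℝ) : spreadingSeminorm hx (y, a.mapDomain σ) = spreadingSeminorm hx (y, a) := by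
  have h0 : ∀ j, (∀ i < supportBound a, σ i ≠ j) → a.mapDomain σ j = 0 := by
    intro j hj
    by_cases hr : j ∈ Set.range σ
    · obtain ⟨i, rfl⟩ := hr
      rw [Finsupp.mapDomain_apply hσ.injective]
      exact eq_zero_of_supportBound_le (not_lt.1 fun hi => hj i hi rfl)
    · exact Finsupp.mapDomain_of_notMem_range a j hr
  rw [spreadingSeminorm_eq hx (v := (y, a.mapDomain σ)) (N := σ (supportBound a))
      fun j hj => h0 j fun i hi => ((hσ hi).trans_le hj).ne,
    spreadingSeminorm_eq hx (v := (y, a)) fun j hj => eq_zero_of_supportBound_le hj]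
  exact iteratedLimit_spread hx hσ (fun i => Finsupp.mapDomain_apply hσ.injective a i) _ _ y
    (fun i hi => hσ hi) fun j _ => h0 j

lemma spreadingSeminorm_approx (hx : ∀ n, ‖x n‖ ≤ B) (s : Finset (Y × (ℕ →₀ ℝ))) {ε : ℝ}
    (hε : 0 < ε) : ∃ J : Y × (ℕ →₀ ℝ) →ₗ[ℝ] Y, ∀ v ∈ s, |spreadingSeminorm hx v - ‖J v‖| < ε := by
  let N := s.sup fun v => supportBound v.2
  obtain ⟨n, hn⟩ := exists_approx_iteratedLimit hx N s ε hε
  refine ⟨LinearMap.coprod LinearMap.id (Finsupp.linearCombination ℝ fun i => x (n i)),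
    fun v hv => ?_⟩
  have hvN : ∀ j, N ≤ j → v.2 j = 0 := fun j hj => eq_zero_of_supportBound_le
    ((Finset.le_sup (f := fun v : Y × (ℕ →₀ ℝ) => supportBound v.2) hv).trans hj)
  rw [spreadingSeminorm_eq hx hvN]
  have h1 : Finsupp.linearCombination ℝ (fun i => x (n i)) v.2 =
      ∑ i ∈ Finset.range N, v.2 i • x (n i) := by
    rw [Finsupp.linearCombination_apply]
    refine Finsupp.sum_of_support_subset _ (fun i hi => ?_) _ (fun i _ => zero_smul _ _)
    rw [Finset.mem_range]
    by_contra h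
    exact Finsupp.mem_support_iff.1 hi (hvN i (not_lt.1 h))
  simpa [h1] using hn v hv

end SpreadingModel

section UnconditionalSpreading

variable {Y : Type*} [NormedAddCommGroup Y] [NormedSpace ℝ Y]

/-- A seminorm on `Y × (ℕ →₀ ℝ)` extending the norm of `Y` which is invariant under spreading and
decreases when a coordinate is suppressed. -/
structure IsUnconditionalSpreading (p : Seminorm ℝ (Y × (ℕ →₀ ℝ))) (B : ℝ) : Prop where
  apply_zero : ∀ y, p (y, 0) = ‖y‖
  apply_mapDomain : ∀ {σ : ℕ → ℕ}, StrictMono σ → ∀ y a, p (y, a.mapDomain σ) = p (y, a)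
  apply_erase_le : ∀ y a j, p (y, a.erase j) ≤ p (y, a)
  one_le : 1 ≤ p (0, Finsupp.single 0 1)
  le_bound : p (0, Finsupp.single 0 1) ≤ B

/-- The linear map sending the unit vector `e i` to `e (2 * i) - e (2 * i + 1)`. -/
noncomputable def differenceMap : (ℕ →₀ ℝ) →ₗ[ℝ] (ℕ →₀ ℝ) :=
  Finsupp.lmapDomain ℝ ℝ (fun i => 2 * i) - Finsupp.lmapDomain ℝ ℝ (fun i => 2 * i + 1)

lemma differenceMap_apply (a : ℕ →₀ ℝ) : differenceMap a =
    a.mapDomain (fun i => 2 * i) - a.mapDomain (fun i => 2 * i + 1) := rfl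

lemma mapDomain_sub_real (σ : ℕ → ℕ) (a b : ℕ →₀ ℝ) :
    (a - b).mapDomain σ = a.mapDomain σ - b.mapDomain σ :=
  map_sub (Finsupp.lmapDomain ℝ ℝ σ) a b

lemma mapDomain_differenceMap (σ : ℕ → ℕ) (a : ℕ →₀ ℝ) : (differenceMap a).mapDomain σ =
    a.mapDomain (fun i => σ (2 * i)) - a.mapDomain (fun i => σ (2 * i + 1)) := by
  rw [differenceMap_apply, mapDomain_sub_real, ← Finsupp.mapDomain_comp, ← Finsupp.mapDomain_comp]
  rfl

lemma differenceMap_mapDomain {σ : ℕ → ℕ} (a : ℕ →₀ ℝ) :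
    differenceMap (a.mapDomain σ) =
      (differenceMap a).mapDomain (fun i => 2 * σ (i / 2) + i % 2) := by
  rw [mapDomain_differenceMap, differenceMap_apply, ← Finsupp.mapDomain_comp,
    ← Finsupp.mapDomain_comp]
  congr 2
  · funext i; simp
  · funext i
    have h1 : (2 * i + 1) / 2 = i := by omega
    have h2 : (2 * i + 1) % 2 = 1 := by omega
    simp [h1, h2]

lemma strictMono_double {σ : ℕ → ℕ} (hσ : StrictMono σ) :
    StrictMono fun i => 2 * σ (i / 2) + i % 2 := by
  refine strictMono_nat_of_lt_succ fun i => ?_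
  rcases Nat.even_or_odd' i with ⟨k, rfl | rfl⟩
  · have h1 : (2 * k + 1) / 2 = k := by omega
    have h2 : 2 * k / 2 = k := by omega
    rw [h1, h2]; omega
  · have h1 : (2 * k + 1) / 2 = k := by omega
    have h2 : (2 * k + 1 + 1) / 2 = k + 1 := by omega
    have h3 := hσ (Nat.lt_add_one k)
    rw [h1, h2]; omega

/-- Spreading invariance makes differences of consecutive unit vectors suppressible. -/
lemma apply_differenceMap_erase_le {p : Seminorm ℝ (Y × (ℕ →₀ ℝ))}
    (hp : ∀ {σ : ℕ → ℕ}, StrictMono σ → ∀ y a, p (y, a.mapDomain σ) = p (y, a)) (y : Y)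
    (a : ℕ →₀ ℝ) (j : ℕ) :
    p (y, differenceMap (a.erase j)) ≤ p (y, differenceMap a) := by
  set e := a.erase j with he
  set t := a j with ht
  have hae : a = e + Finsupp.single j t := (Finsupp.erase_add_single j a).symm
  have hej : ∀ i ∈ e.support, i ≠ j := fun i hi h => by simp [he, h] at hi
  have hsingle : ∀ i, p (0, Finsupp.single i t) = p (0, Finsupp.single 0 t) := by
    intro i
    rw [← hp (σ := fun k => k + i) (fun _ _ h => Nat.add_lt_add_right h i) 0 (Finsupp.single 0 t),
      Finsupp.mapDomain_single, zero_add]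
  have key : ∀ m : ℕ, m * p (y, differenceMap e) ≤
      m * p (y, differenceMap a) + 2 * p (0, Finsupp.single 0 t) := by
    intro m
    let τ : ℕ → ℕ := fun i => if i < 2 * j then i else i + m
    have hτ : StrictMono τ := strictMono_nat_of_lt_succ fun i => by
      simp only [τ]; split_ifs <;> omega
    let σ : ℕ → ℕ → ℕ := fun k i => if i < 2 * j then i else if i < 2 * j + 2 then i + k else i + m
    have hσ : ∀ k < m, StrictMono (σ k) := fun k hk => strictMono_nat_of_lt_succ fun i => by
      simp only [σ]; split_ifs <;> omega
    have h1 : ∀ k, (differenceMap a).mapDomain (σ k) = (differenceMap e).mapDomain τ +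
        (Finsupp.single (2 * j + k) t - Finsupp.single (2 * j + (k + 1)) t) := by
      intro k
      have h2 : (differenceMap e).mapDomain (σ k) = (differenceMap e).mapDomain τ := by
        rw [mapDomain_differenceMap, mapDomain_differenceMap]
        congr 1 <;> refine Finsupp.mapDomain_congr fun i hi => ?_ <;> have := hej i hi <;>
          simp only [σ, τ] <;> split_ifs <;> omega
      rw [hae, map_add, Finsupp.mapDomain_add, h2, mapDomain_differenceMap (σ k) (Finsupp.single j t),
        Finsupp.mapDomain_single, Finsupp.mapDomain_single]
      have h3 : σ k (2 * j) = 2 * j + k := by simp [σ]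
      have h4 : σ k (2 * j + 1) = 2 * j + (k + 1) := by simp [σ]; omega
      rw [h3, h4]
    have h2 : ∀ n : ℕ, ∑ k ∈ Finset.range n, (y, (differenceMap a).mapDomain (σ k)) =
        (n : ℝ) • (y, (differenceMap e).mapDomain τ) +
          ((0 : Y), Finsupp.single (2 * j) t - Finsupp.single (2 * j + n) t) := by
      intro n
      induction n with
      | zero => ext1 <;> simp
      | succ n ih =>
        rw [Finset.sum_range_succ, ih, h1]
        ext1
        · simp [add_smul]
        · simp only [Prod.snd_add, Prod.smul_snd, Nat.cast_add, Nat.cast_one, add_smul, one_smul]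
          abel
    have h3 : (m : ℝ) • (y, (differenceMap e).mapDomain τ) =
        ∑ k ∈ Finset.range m, (y, (differenceMap a).mapDomain (σ k)) +
          (((0 : Y), Finsupp.single (2 * j + m) t) - ((0 : Y), Finsupp.single (2 * j) t)) := by
      rw [h2]
      ext1
      · simp
      · simp only [Prod.snd_add, Prod.smul_snd, Prod.snd_sub]
        abel
    calc (m : ℝ) * p (y, differenceMap e)
        = p ((m : ℝ) • (y, (differenceMap e).mapDomain τ)) := by
          rw [map_smul_eq_mul, Real.norm_of_nonneg m.cast_nonneg, hp hτ]
      _ ≤ ∑ k ∈ Finset.range m, p (y, (differenceMap a).mapDomain (σ k)) +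
          (p (0, Finsupp.single (2 * j + m) t) + p (0, Finsupp.single (2 * j) t)) := by
          rw [h3]
          refine (map_add_le_add p _ _).trans (add_le_add ?_ (map_sub_le_add p _ _))
          exact Finset.le_sum_of_subadditive p (map_zero p).le (map_add_le_add p) _ _
      _ = _ := by
          rw [Finset.sum_congr rfl fun k hk => hp (hσ k (Finset.mem_range.1 hk)) y _,
            hsingle (2 * j + m), hsingle (2 * j), Finset.sum_const, Finset.card_range, nsmul_eq_mul]
          ring
  by_contra! hlt
  obtain ⟨m, hm⟩ := exists_nat_gt
    (2 * p (0, Finsupp.single 0 t) / (p (y, differenceMap e) - p (y, differenceMap a)))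
  rw [div_lt_iff₀ (sub_pos.2 hlt)] at hm
  linarith [key m]

variable {p : Seminorm ℝ (Y × (ℕ →₀ ℝ))} {B : ℝ}

namespace IsUnconditionalSpreading

lemma apply_single (hp : IsUnconditionalSpreading p B) (i : ℕ) (t : ℝ) :
    p (0, Finsupp.single i t) = |t| * p (0, Finsupp.single 0 1) := by
  have h1 : ((0 : Y), Finsupp.single i t) =
      t • ((0 : Y), (Finsupp.single 0 (1 : ℝ)).mapDomain (fun k => k + i)) := by
    simp [Finsupp.mapDomain_single]
  rw [h1, map_smul_eq_mul, hp.apply_mapDomain fun _ _ h => Nat.add_lt_add_right h i,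
    Real.norm_eq_abs]

lemma apply_le_of_contraction (hp : IsUnconditionalSpreading p B) (y : Y) {a b : ℕ →₀ ℝ}
    (hab : ∀ i, ∃ t : ℝ, 0 ≤ t ∧ t ≤ 1 ∧ b i = t * a i) : p (y, b) ≤ p (y, a) := by
  classical
  have key : ∀ (S : Finset ℕ) (a : ℕ →₀ ℝ), (∀ i, ∃ t : ℝ, 0 ≤ t ∧ t ≤ 1 ∧ b i = t * a i) →
      (∀ i ∉ S, b i = a i) → p (y, b) ≤ p (y, a) := by
    intro S
    induction S using Finset.induction_on with
    | empty => intro a _ h; rw [show b = a from Finsupp.ext fun i => h i (by simp)]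
    | insert j S hj ih =>
      intro a h h'
      obtain ⟨t, ht0, ht1, ht⟩ := h j
      have h1 := ih (t • a + (1 - t) • a.erase j) (fun i => ?_) (fun i hi => ?_)
      · refine h1.trans ?_
        have h2 : (y, t • a + (1 - t) • a.erase j) = t • (y, a) + (1 - t) • (y, a.erase j) := by
          ext1
          · simp [← add_smul]
          · rfl
        rw [h2]
        refine (map_add_le_add p _ _).trans ?_
        rw [map_smul_eq_mul, map_smul_eq_mul, Real.norm_of_nonneg ht0,
          Real.norm_of_nonneg (sub_nonneg.2 ht1)]
        nlinarith [hp.apply_erase_le y a j]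
      · by_cases hij : i = j
        · subst hij
          exact ⟨1, zero_le_one, le_rfl, by simp [ht]⟩
        · obtain ⟨s, h⟩ := h i
          refine ⟨s, h.1, h.2.1, ?_⟩
          rw [h.2.2, Finsupp.add_apply, Finsupp.smul_apply, Finsupp.smul_apply,
            Finsupp.erase_ne hij]
          simp only [smul_eq_mul]; ring
      · by_cases hij : i = j
        · subst hij; simp [ht]
        · rw [h' i (by simp [hij, hi]), Finsupp.add_apply, Finsupp.smul_apply, Finsupp.smul_apply,
            Finsupp.erase_ne hij]
          simp only [smul_eq_mul]; ring
  refine key a.support a hab fun i hi => ?_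
  obtain ⟨t, -, -, h⟩ := hab i
  rw [h, Finsupp.notMem_support_iff.1 hi, mul_zero]

lemma norm_le (hp : IsUnconditionalSpreading p B) (y : Y) (a : ℕ →₀ ℝ) : ‖y‖ ≤ p (y, a) := by
  rw [← hp.apply_zero]
  exact hp.apply_le_of_contraction y fun i => ⟨0, le_rfl, zero_le_one, by simp⟩

lemma apply_zero_le (hp : IsUnconditionalSpreading p B) (y : Y) (a : ℕ →₀ ℝ) :
    p (0, a) ≤ 2 * p (y, a) := by
  have h1 : ((0 : Y), a) = (y, a) - (y, 0) := by simp
  have h2 := map_sub_le_add p (y, a) (y, 0)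
  rw [← h1, hp.apply_zero] at h2
  linarith [hp.norm_le y a]

lemma abs_le (hp : IsUnconditionalSpreading p B) (a : ℕ →₀ ℝ) (j : ℕ) : |a j| ≤ p (0, a) := by
  have h1 : p (0, Finsupp.single j (a j)) ≤ p (0, a) :=
    hp.apply_le_of_contraction 0 fun i => by
      by_cases hij : i = j
      · exact ⟨1, zero_le_one, le_rfl, by simp [hij]⟩
      · exact ⟨0, le_rfl, zero_le_one, by simp [Finsupp.single_eq_of_ne hij]⟩
  rw [hp.apply_single] at h1
  nlinarith [hp.one_le, abs_nonneg (a j)]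

lemma apply_le_two_mul (hp : IsUnconditionalSpreading p B) {a b : ℕ →₀ ℝ}
    (hab : ∀ i, |b i| ≤ |a i|) : p (0, b) ≤ 2 * p (0, a) := by
  classical
  let q : ℕ → Prop := fun i => 0 ≤ b i * a i
  have h0 : ∀ i, ∃ t : ℝ, 0 ≤ t ∧ t ≤ 1 ∧ |b i| = t * |a i| := by
    intro i
    by_cases ha : a i = 0
    · exact ⟨0, le_rfl, zero_le_one, by have := hab i; rw [ha, abs_zero] at this; simpa using this⟩
    · exact ⟨|b i| / |a i|, by positivity, div_le_one_of_le₀ (hab i) (abs_nonneg _), by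
        rw [div_mul_cancel₀ _ (abs_ne_zero.2 ha)]⟩
  have h1 : ∀ i, 0 ≤ b i * a i → ∃ t : ℝ, 0 ≤ t ∧ t ≤ 1 ∧ b i = t * a i := by
    intro i hi
    obtain ⟨t, ht0, ht1, ht⟩ := h0 i
    refine ⟨t, ht0, ht1, ?_⟩
    rcases mul_nonneg_iff.1 hi with ⟨hb, ha⟩ | ⟨hb, ha⟩
    · rwa [abs_of_nonneg hb, abs_of_nonneg ha] at ht
    · rw [abs_of_nonpos hb, abs_of_nonpos ha] at ht; linarith
  have h2 : ∀ i, ¬0 ≤ b i * a i → ∃ t : ℝ, 0 ≤ t ∧ t ≤ 1 ∧ b i = t * (-a i) := by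
    intro i hi
    obtain ⟨t, ht0, ht1, ht⟩ := h0 i
    refine ⟨t, ht0, ht1, ?_⟩
    rcases mul_neg_iff.1 (not_le.1 hi) with ⟨hb, ha⟩ | ⟨hb, ha⟩
    · rwa [abs_of_pos hb, abs_of_neg ha] at ht
    · rw [abs_of_neg hb, abs_of_pos ha] at ht; linarith
  have h3 : p (0, b.filter q) ≤ p (0, a) := hp.apply_le_of_contraction 0 fun i => by
    by_cases hi : q i
    · rw [Finsupp.filter_apply_pos _ _ hi]; exact h1 i hi
    · rw [Finsupp.filter_apply_neg _ _ hi]; exact ⟨0, le_rfl, zero_le_one, by simp⟩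
  have h4 : p (0, b.filter fun i => ¬q i) ≤ p (0, -a) := hp.apply_le_of_contraction 0 fun i => by
    by_cases hi : q i
    · rw [Finsupp.filter_apply_neg _ _ (by simpa using hi)]
      exact ⟨0, le_rfl, zero_le_one, by simp⟩
    · rw [Finsupp.filter_apply_pos (fun i => ¬q i) _ hi]; exact h2 i hi
  have h5 : p (0, -a) = p (0, a) := by
    rw [show ((0 : Y), -a) = -(0, a) by simp, map_neg_eq_map]
  have h6 : ((0 : Y), b) = (0, b.filter q) + (0, b.filter fun i => ¬q i) := by
    rw [Prod.mk_add_mk, Finsupp.filter_add_filter_not, add_zero]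
  rw [h6]
  linarith [map_add_le_add p ((0 : Y), b.filter q) (0, b.filter fun i => ¬q i)]

lemma eq_zero_of_apply_eq_zero (hp : IsUnconditionalSpreading p B) {v : Y × (ℕ →₀ ℝ)}
    (hv : p v = 0) : v = 0 := by
  obtain ⟨y, a⟩ := v
  have h1 := hp.norm_le y a
  have h2 := hp.apply_zero_le y a
  rw [hv] at h1 h2
  refine Prod.ext (norm_le_zero_iff.1 h1) (Finsupp.ext fun i => abs_nonpos_iff.1 ?_)
  linarith [hp.abs_le a i]

end IsUnconditionalSpreading

lemma one_le_spreadingSeminorm {x : ℕ → Y} (hx : ∀ n, ‖x n‖ ≤ B)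
    (hx1 : ∀ m n, m ≠ n → 1 ≤ ‖x m - x n‖) :
    1 ≤ spreadingSeminorm hx (0, Finsupp.single 0 1 - Finsupp.single 1 1) := by
  rw [spreadingSeminorm_eq hx (N := 2) fun j hj => by
    have h1 : 0 ≠ j := by omega
    have h2 : 1 ≠ j := by omega
    simp [h1, h2]]
  refine ge_of_tendsto' (tendsto_iteratedLimit hx 1 _ _) fun n => ?_
  refine ge_of_tendsto (tendsto_iteratedLimit hx 0 _ _) ?_
  have h1 : ∀ᶠ m in (hyperfilter ℕ : Filter ℕ), m ≠ n :=
    Filter.hyperfilter_le_cofinite (Set.finite_singleton n).compl_mem_cofinite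
  filter_upwards [h1] with m hm
  have h2 := hx1 m n hm
  simpa [iteratedLimit, sub_eq_neg_add] using h2

lemma exists_isUnconditionalSpreading (hfin : ¬FiniteDimensional ℝ Y) {c : ℝ} (hc : 0 ≤ c)
    (hY : UniformlyComplemented (normSeminorm ℝ Y) c) :
    ∃ p : Seminorm ℝ (Y × (ℕ →₀ ℝ)),
      IsUnconditionalSpreading p 4 ∧ UniformlyComplemented (V := Y × (ℕ →₀ ℝ)) p (4 * c) := by
  classical
  obtain ⟨x, hx, hx1⟩ := exists_seq_norm_le_one_le_norm_sub' (𝕜 := ℝ) (E := Y)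
    (c := (3 / 2 : ℝ)) (by norm_num) (R := 2) (by norm_num) hfin
  let T : Y × (ℕ →₀ ℝ) →ₗ[ℝ] Y × (ℕ →₀ ℝ) := LinearMap.prodMap LinearMap.id differenceMap
  have hT : ∀ y a, T (y, a) = (y, differenceMap a) := fun y a => rfl
  let p := (spreadingSeminorm hx).comp T
  have hpa : ∀ v, p v = spreadingSeminorm hx (T v) := fun v => rfl
  have hsingle : ∀ i, spreadingSeminorm hx (0, Finsupp.single i 1) ≤ 2 := by
    intro i
    have h1 := spreadingSeminorm_mapDomain hx (σ := fun k => k + i)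
      (fun _ _ h => Nat.add_lt_add_right h i) 0 (Finsupp.single 0 1)
    rw [Finsupp.mapDomain_single, zero_add] at h1
    rw [h1, spreadingSeminorm_eq hx (N := 1) fun j hj => by
      have h1 : 0 ≠ j := by omega
      simp [h1]]
    refine (iteratedLimit_le hx _ _ _).trans ?_
    simp
  have hp : IsUnconditionalSpreading p 4 :=
    { apply_zero := fun y => by
        rw [hpa, hT, map_zero, spreadingSeminorm_eq hx (N := 0) fun j _ => rfl]
        rfl
      apply_mapDomain := fun hσ y a => by
        rw [hpa, hpa, hT, hT, differenceMap_mapDomain,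
          spreadingSeminorm_mapDomain hx (strictMono_double hσ)]
      apply_erase_le := fun y a j =>
        apply_differenceMap_erase_le (fun hσ y a => spreadingSeminorm_mapDomain hx hσ y a) y a j
      one_le := by
        have h := one_le_spreadingSeminorm hx hx1
        rw [hpa, hT, differenceMap_apply, Finsupp.mapDomain_single, Finsupp.mapDomain_single]
        simpa using h
      le_bound := by
        rw [hpa, hT, differenceMap_apply, Finsupp.mapDomain_single, Finsupp.mapDomain_single]
        have h1 : ((0 : Y), Finsupp.single (2 * 0) (1 : ℝ) - Finsupp.single (2 * 0 + 1) 1) =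
            (0, Finsupp.single (2 * 0) 1) - (0, Finsupp.single (2 * 0 + 1) 1) := by simp
        rw [h1]
        refine (map_sub_le_add _ _ _).trans ?_
        linarith [hsingle (2 * 0), hsingle (2 * 0 + 1)] }
  refine ⟨p, hp, hY.of_finitely_representable hc (fun v => hp.eq_zero_of_apply_eq_zero)
    fun V hV => ?_⟩
  obtain ⟨J, -, hJ⟩ := exists_linearMap_equivalent (p := p) (Y := Y) (S := Set.univ) hV
    (fun v _ => hp.eq_zero_of_apply_eq_zero) fun s ε hε => by
      obtain ⟨J, hJ⟩ := spreadingSeminorm_approx hx (s.image T) hε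
      exact ⟨J ∘ₗ T, trivial, fun v hv => hJ _ (Finset.mem_image_of_mem T hv)⟩
  exact ⟨J, hJ⟩

end UnconditionalSpreading

section FundamentalFunction

/-- The finitely supported sequence `∑ i ∈ A, f i • e i`. -/
noncomputable def sumSingle (A : Finset ℕ) (f : ℕ → ℝ) : ℕ →₀ ℝ :=
  ∑ i ∈ A, Finsupp.single i (f i)

lemma sumSingle_apply (A : Finset ℕ) (f : ℕ → ℝ) (i : ℕ) :
    sumSingle A f i = if i ∈ A then f i else 0 := by
  classical
  rw [sumSingle, Finsupp.finsetSum_apply]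
  simp only [Finsupp.single_apply]
  rw [Finset.sum_ite_eq' A i f]

lemma sumSingle_range_map (A : Finset ℕ) (f : ℕ → ℝ) {σ : ℕ → ℕ} (hσ : StrictMono σ) :
    sumSingle (A.map ⟨σ, hσ.injective⟩) f = (sumSingle A fun i => f (σ i)).mapDomain σ := by
  rw [sumSingle, sumSingle, Finset.sum_map, Finsupp.mapDomain_finsetSum]
  exact Finset.sum_congr rfl fun i _ => Finsupp.mapDomain_single.symm

lemma exists_strictMono_map_range (A : Finset ℕ) : ∃ (σ : ℕ → ℕ) (hσ : StrictMono σ),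
    (Finset.range A.card).map ⟨σ, hσ.injective⟩ = A := by
  induction A using Finset.induction_on_max with
  | empty => exact ⟨id, strictMono_id, by simp⟩
  | insert m A hA ih =>
    obtain ⟨σ, hσ, hσA⟩ := ih
    have hmA : m ∉ A := fun h => lt_irrefl _ (hA m h)
    have hlt : ∀ i < A.card, σ i < m := fun i hi => hA _ (by
      rw [← hσA]; exact Finset.mem_map_of_mem _ (Finset.mem_range.2 hi))
    refine ⟨fun i => if i < A.card then σ i else m + (i - A.card), strictMono_nat_of_lt_succ fun i => ?_, ?_⟩
    · have h1 := hσ (Nat.lt_add_one i)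
      have h2 := hlt i
      split_ifs <;> omega
    · rw [Finset.card_insert_of_notMem hmA, Finset.range_add_one, Finset.map_insert]
      congr 1
      · simp
      · conv_rhs => rw [← hσA]
        rw [Finset.map_eq_image, Finset.map_eq_image]
        exact Finset.image_congr fun i hi => if_pos (Finset.mem_range.1 hi)

variable {Y : Type*} [NormedAddCommGroup Y] [NormedSpace ℝ Y]
  {p : Seminorm ℝ (Y × (ℕ →₀ ℝ))} {B : ℝ}

/-- The norm of a sum of `n` unit vectors. -/
noncomputable def fundamentalFunction (p : Seminorm ℝ (Y × (ℕ →₀ ℝ))) (n : ℕ) : ℝ :=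
  p (0, sumSingle (Finset.range n) fun _ => 1)

namespace IsUnconditionalSpreading

lemma apply_sumSingle_one (hp : IsUnconditionalSpreading p B) (A : Finset ℕ) :
    p (0, sumSingle A fun _ => 1) = fundamentalFunction p A.card := by
  obtain ⟨σ, hσ, hA⟩ := exists_strictMono_map_range A
  conv_lhs => rw [← hA, sumSingle_range_map _ _ hσ, hp.apply_mapDomain hσ]
  rfl

lemma fundamentalFunction_mono (hp : IsUnconditionalSpreading p B) :
    Monotone (fundamentalFunction p) := fun m n hmn =>
  hp.apply_le_of_contraction 0 fun i => by
    by_cases hi : i < m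
    · exact ⟨1, zero_le_one, le_rfl, by simp [sumSingle_apply, hi, hi.trans_le hmn]⟩
    · exact ⟨0, le_rfl, zero_le_one, by simp [sumSingle_apply, hi]⟩

lemma one_le_fundamentalFunction (hp : IsUnconditionalSpreading p B) {n : ℕ} (hn : 1 ≤ n) :
    1 ≤ fundamentalFunction p n := by
  refine le_trans ?_ (hp.fundamentalFunction_mono hn)
  simpa [fundamentalFunction, sumSingle] using hp.one_le

lemma apply_rotate_le (hp : IsUnconditionalSpreading p B) {N m : ℕ} (hm : m < N) (c : ℕ → ℝ) :
    p (0, sumSingle (Finset.range N) fun l => c ((m + l) % N)) ≤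
      2 * p (0, sumSingle (Finset.range N) c) := by
  have h1 : p (0, sumSingle (Finset.range (N - m)) fun l => c (l + m)) ≤
      p (0, sumSingle (Finset.range N) c) := by
    have hσ : StrictMono fun l : ℕ => l + m := fun _ _ h => Nat.add_lt_add_right h m
    rw [← hp.apply_mapDomain hσ, ← sumSingle_range_map _ _ hσ]
    refine hp.apply_le_of_contraction 0 fun i => ?_
    rw [sumSingle_apply, sumSingle_apply]
    split_ifs with h h'
    · exact ⟨1, zero_le_one, le_rfl, by simp⟩
    · simp at h h'; omega
    · exact ⟨0, le_rfl, zero_le_one, by simp⟩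
    · exact ⟨0, le_rfl, zero_le_one, by simp⟩
  have h2 : p (0, sumSingle (Finset.Ico (N - m) N) fun l => c (l + m - N)) ≤
      p (0, sumSingle (Finset.range N) c) := by
    have hσ : StrictMono fun l : ℕ => l + (N - m) := fun _ _ h => Nat.add_lt_add_right h _
    have h3 : sumSingle (Finset.Ico (N - m) N) (fun l => c (l + m - N)) =
        (sumSingle (Finset.range m) c).mapDomain fun l : ℕ => l + (N - m) := by
      have h4 : Finset.Ico (N - m) N = (Finset.range m).map ⟨_, hσ.injective⟩ := by
        ext i
        simp only [Finset.mem_Ico, Finset.mem_map, Finset.mem_range, Function.Embedding.coeFn_mk]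
        exact ⟨fun h => ⟨i - (N - m), by omega, by omega⟩, by rintro ⟨j, hj, rfl⟩; omega⟩
      rw [h4, sumSingle_range_map _ _ hσ]
      congr 3
      funext l
      congr 1
      omega
    rw [h3, hp.apply_mapDomain hσ]
    refine hp.apply_le_of_contraction 0 fun i => ?_
    rw [sumSingle_apply, sumSingle_apply]
    split_ifs with h h'
    · exact ⟨1, zero_le_one, le_rfl, by simp⟩
    · simp at h h'; omega
    · exact ⟨0, le_rfl, zero_le_one, by simp⟩
    · exact ⟨0, le_rfl, zero_le_one, by simp⟩
  have h3 : ((0 : Y), sumSingle (Finset.range N) fun l => c ((m + l) % N)) =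
      (0, sumSingle (Finset.range (N - m)) fun l => c (l + m)) +
        (0, sumSingle (Finset.Ico (N - m) N) fun l => c (l + m - N)) := by
    rw [Prod.mk_add_mk, add_zero]
    congr 1
    ext l
    rw [Finsupp.add_apply, sumSingle_apply, sumSingle_apply, sumSingle_apply]
    by_cases h4 : l < N - m
    · have h5 : (m + l) % N = l + m := by rw [Nat.mod_eq_of_lt] <;> omega
      have h6 : l < N := by omega
      have h7 : ¬(N - m ≤ l) := by omega
      simp [h4, h5, h6, h7]
    · by_cases h6 : l < N
      · have h5 : (m + l) % N = l + m - N := by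
          rw [Nat.mod_eq_sub_mod (by omega), Nat.mod_eq_of_lt] <;> omega
        simp only [Finset.mem_range, Finset.mem_Ico, h4, h6, h5]
        simp; omega
      · simp [h4, h6]
  rw [h3]
  linarith [map_add_le_add p ((0 : Y), sumSingle (Finset.range (N - m)) fun l => c (l + m))
    (0, sumSingle (Finset.Ico (N - m) N) fun l => c (l + m - N))]

lemma sum_rotate (c : ℕ → ℝ) (N l : ℕ) :
    ∑ m ∈ Finset.range N, c ((m + l) % N) = ∑ i ∈ Finset.range N, c i := by
  have h1 := congrArg (fun s : Multiset ℕ => (s.map c).sum) (Nat.multiset_Ico_map_mod l N)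
  simp only [Multiset.map_map] at h1
  have h2 : ∑ i ∈ Finset.Ico l (l + N), c (i % N) = ∑ i ∈ Finset.range N, c i := h1
  rw [← h2, Finset.sum_Ico_eq_sum_range, Nat.add_sub_cancel_left]
  exact Finset.sum_congr rfl fun m _ => by rw [add_comm]

/-- Averaging over cyclic permutations. -/
lemma sum_abs_mul_le (hp : IsUnconditionalSpreading p B) (N : ℕ) (c : ℕ → ℝ) :
    (∑ i ∈ Finset.range N, |c i|) * fundamentalFunction p N ≤
      4 * N * p (0, sumSingle (Finset.range N) c) := by
  have h1 : (∑ i ∈ Finset.range N, |c i|) • ((0 : Y), sumSingle (Finset.range N) fun _ => 1) =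
      ∑ m ∈ Finset.range N, (0, sumSingle (Finset.range N) fun l => |c ((m + l) % N)|) := by
    ext1
    · simp [Prod.fst_sum]
    · rw [Prod.snd_sum, Prod.smul_snd]
      ext l
      rw [Finsupp.smul_apply, Finsupp.finsetSum_apply]
      simp only [sumSingle_apply]
      split_ifs
      · rw [sum_rotate fun i => |c i|]; simp
      · simp
  have h2 : p (0, sumSingle (Finset.range N) fun i => |c i|) ≤
      2 * p (0, sumSingle (Finset.range N) c) := hp.apply_le_two_mul fun i => by
    rw [sumSingle_apply, sumSingle_apply]; split_ifs <;> simp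
  have h3 : ∑ m ∈ Finset.range N, p (0, sumSingle (Finset.range N) fun l => |c ((m + l) % N)|) ≤
      N * (2 * (2 * p (0, sumSingle (Finset.range N) c))) := by
    refine (Finset.sum_le_card_nsmul _ _ (2 * (2 * p (0, sumSingle (Finset.range N) c)))
      fun m hm => ?_).trans_eq (by rw [Finset.card_range, nsmul_eq_mul])
    exact (hp.apply_rotate_le (Finset.mem_range.1 hm) fun i => |c i|).trans (by linarith)
  calc (∑ i ∈ Finset.range N, |c i|) * fundamentalFunction p N
      = p ((∑ i ∈ Finset.range N, |c i|) • ((0 : Y), sumSingle (Finset.range N) fun _ => 1)) := by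
        rw [map_smul_eq_mul, Real.norm_of_nonneg (Finset.sum_nonneg fun _ _ => abs_nonneg _)]
        rfl
    _ ≤ _ := by
        rw [h1]
        exact Finset.le_sum_of_subadditive p (map_zero p).le (map_add_le_add p) _ _
    _ ≤ _ := h3
    _ = _ := by ring

end IsUnconditionalSpreading

end FundamentalFunction

section Hadamard

/-- The entries of the Sylvester-Hadamard matrix of order `2 ^ k`. -/
def hadamard : ℕ → ℕ → ℕ → ℝ
  | 0, _, _ => 1
  | k + 1, i, j => hadamard k (i % 2 ^ k) (j % 2 ^ k) * if 2 ^ k ≤ i ∧ 2 ^ k ≤ j then -1 else 1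

lemma abs_hadamard_le (k i j : ℕ) : |hadamard k i j| ≤ 1 := by
  induction k generalizing i j with
  | zero => simp [hadamard]
  | succ k ih =>
    rw [hadamard, abs_mul]
    split_ifs <;> simpa using ih _ _

lemma hadamard_mul_self (k : ℕ) : ∀ i < 2 ^ k, ∀ l < 2 ^ k,
    ∑ j ∈ Finset.range (2 ^ k), hadamard k i j * hadamard k j l =
      if i = l then ((2 ^ k : ℕ) : ℝ) else 0 := by
  induction k with
  | zero =>
    intro i hi l hl
    have h1 : i = 0 := by omega
    have h2 : l = 0 := by omega
    simp [hadamard, h1, h2]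
  | succ k ih =>
    intro i hi l hl
    have hpos : 0 < 2 ^ k := by positivity
    have h0 := ih (i % 2 ^ k) (Nat.mod_lt _ hpos) (l % 2 ^ k) (Nat.mod_lt _ hpos)
    have hsucc : 2 ^ (k + 1) = 2 ^ k + 2 ^ k := by ring
    have h1 : ∀ j ∈ Finset.range (2 ^ k), hadamard (k + 1) i j * hadamard (k + 1) j l =
        hadamard k (i % 2 ^ k) j * hadamard k j (l % 2 ^ k) := by
      intro j hj
      rw [Finset.mem_range] at hj
      simp [hadamard, not_le.2 hj, Nat.mod_eq_of_lt hj]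
    have h2 : ∀ j ∈ Finset.range (2 ^ k),
        hadamard (k + 1) i (2 ^ k + j) * hadamard (k + 1) (2 ^ k + j) l =
        hadamard k (i % 2 ^ k) j * hadamard k j (l % 2 ^ k) *
          ((if 2 ^ k ≤ i then -1 else 1) * if 2 ^ k ≤ l then -1 else 1) := by
      intro j hj
      rw [Finset.mem_range] at hj
      simp only [hadamard, Nat.add_mod_left, Nat.mod_eq_of_lt hj, Nat.le_add_right, and_true,
        true_and]
      ring
    rw [hsucc, Finset.sum_range_add, Finset.sum_congr rfl h1, Finset.sum_congr rfl h2,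
      ← Finset.sum_mul, h0]
    have h3 : ∀ m < 2 ^ (k + 1), m % 2 ^ k = if 2 ^ k ≤ m then m - 2 ^ k else m := by
      intro m hm
      split_ifs with h
      · rw [Nat.mod_eq_sub_mod h, Nat.mod_eq_of_lt (by omega)]
      · exact Nat.mod_eq_of_lt (not_le.1 h)
    rw [h3 i hi, h3 l hl]
    push_cast
    by_cases hi' : 2 ^ k ≤ i <;> by_cases hl' : 2 ^ k ≤ l <;> simp only [hi', hl', if_true, if_false]
    · by_cases h : i = l
      · simp [h]
      · have : ¬(i - 2 ^ k = l - 2 ^ k) := by omega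
        simp [h, this]
    · have : i ≠ l := by rintro rfl; exact hl' hi'
      simp [this]
    · have : i ≠ l := by rintro rfl; exact hi' hl'
      simp [this]
    · by_cases h : i = l <;> simp [h]

end Hadamard

section FundamentalFunctionBounds

variable {Y : Type*} [NormedAddCommGroup Y] [NormedSpace ℝ Y]
  {p : Seminorm ℝ (Y × (ℕ →₀ ℝ))} {B Λ : ℝ}

/-- Projecting onto the graph of a Hadamard matrix and taking the trace. -/
lemma UniformlyComplemented.exists_operator_sum_abs_ge
    (hΛ : UniformlyComplemented (V := Y × (ℕ →₀ ℝ)) p Λ) {N : ℕ} (hN : 1 ≤ N) {H : ℕ → ℕ → ℝ}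
    (hH1 : ∀ i j, |H i j| ≤ 1)
    (hH : ∀ i < N, ∀ l < N, ∑ j ∈ Finset.range N, H i j * H j l = if i = l then (N : ℝ) else 0) :
    ∃ T : (ℕ →₀ ℝ) →ₗ[ℝ] (ℕ →₀ ℝ),
      (∀ f, p (0, T (sumSingle (Finset.range (N + N)) f)) ≤
        Λ * p (0, sumSingle (Finset.range (N + N)) f)) ∧
      N * √N ≤ ∑ j ∈ Finset.range N, ∑ i ∈ Finset.range N,
        (|T (Finsupp.single j 1) (N + i)| + |T (Finsupp.single (N + i) 1) j|) := by
  classical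
  set s : ℝ := (√N)⁻¹ with hs
  have hN0 : (0 : ℝ) < N := by exact_mod_cast hN
  have hsN : s * √N = 1 := inv_mul_cancel₀ (Real.sqrt_pos.2 hN0).ne'
  have hs0 : 0 ≤ s := by positivity
  have hssN : s * s * N = 1 := by
    calc s * s * N = (s * √N) * (s * √N) := by
          nth_rewrite 1 [← Real.mul_self_sqrt hN0.le]; ring
      _ = 1 := by rw [hsN, one_mul]
  let e : ℕ → Y × (ℕ →₀ ℝ) := fun j => (0, Finsupp.single j 1)
  let g : ℕ → Y × (ℕ →₀ ℝ) := fun j => e j + ∑ i ∈ Finset.range N, (s * H i j) • e (N + i)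
  let Z : Submodule ℝ (Y × (ℕ →₀ ℝ)) := Submodule.span ℝ (e '' Finset.range (N + N))
  let G : Submodule ℝ (Y × (ℕ →₀ ℝ)) := Submodule.span ℝ (g '' Finset.range N)
  have heZ : ∀ j < N + N, e j ∈ Z := fun j hj =>
    Submodule.subset_span (Set.mem_image_of_mem e (by simpa using hj))
  have hgG : ∀ j < N, g j ∈ G := fun j hj =>
    Submodule.subset_span (Set.mem_image_of_mem g (by simpa using hj))
  have hGZ : G ≤ Z := by
    refine Submodule.span_le.2 ?_
    rintro _ ⟨j, hj, rfl⟩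
    have hj' : j < N := by simpa using hj
    refine add_mem (heZ j (by omega)) (sum_mem fun i hi => Submodule.smul_mem _ _ (heZ _ ?_))
    have := Finset.mem_range.1 hi
    omega
  have hg2 : ∀ j l, (g j).2 l = Finsupp.single j (1 : ℝ) l +
      ∑ i ∈ Finset.range N, s * H i j * Finsupp.single (N + i) (1 : ℝ) l := by
    intro j l
    simp only [g, e, Prod.snd_add, Prod.snd_sum, Prod.smul_snd, Finsupp.add_apply,
      Finsupp.finsetSum_apply, Finsupp.smul_apply, smul_eq_mul]
  have hg2' : ∀ j < N, ∀ l < N, (g j).2 l = if l = j then 1 else 0 := by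
    intro j hj l hl
    rw [hg2, Finset.sum_eq_zero, add_zero, Finsupp.single_apply]
    · simp only [eq_comm]
    · intro i _
      rw [Finsupp.single_eq_of_ne (by omega), mul_zero]
  have hg2'' : ∀ j < N, ∀ l < N, (g j).2 (N + l) = s * H l j := by
    intro j hj l hl
    rw [hg2, Finsupp.single_eq_of_ne (by omega), zero_add, Finset.sum_eq_single l]
    · simp
    · intro i _ hil
      rw [Finsupp.single_eq_of_ne (by omega), mul_zero]
    · intro h; exact absurd (Finset.mem_range.2 hl) h
  have hG : ∀ z ∈ G, z.1 = 0 ∧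
      ∀ i < N, z.2 (N + i) = s * ∑ l ∈ Finset.range N, H i l * z.2 l := by
    intro z hz
    induction hz using Submodule.span_induction with
    | mem z hz =>
      obtain ⟨j, hj, rfl⟩ := hz
      have hj' : j < N := by simpa using hj
      refine ⟨by simp [g, e, Prod.fst_sum], fun i hi => ?_⟩
      rw [hg2'' j hj' i hi, Finset.sum_eq_single j]
      · rw [hg2' j hj' j hj', if_pos rfl, mul_one]
      · intro l hl hlj
        rw [hg2' j hj' l (Finset.mem_range.1 hl), if_neg hlj, mul_zero]
      · intro h; exact absurd (Finset.mem_range.2 hj') h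
    | zero => simp
    | add z w _ _ hz hw =>
      refine ⟨by simp [hz.1, hw.1], fun i hi => ?_⟩
      simp only [Prod.snd_add, Finsupp.add_apply, hz.2 i hi, hw.2 i hi, mul_add,
        Finset.sum_add_distrib]
    | smul c z _ hz =>
      refine ⟨by simp [hz.1], fun i hi => ?_⟩
      simp only [Prod.smul_snd, Finsupp.smul_apply, hz.2 i hi, smul_eq_mul, Finset.mul_sum]
      exact Finset.sum_congr rfl fun l _ => by ring
  obtain ⟨P, hP⟩ := hΛ G Z (Submodule.fg_span ((Finset.finite_toSet _).image g))
    (Submodule.fg_span ((Finset.finite_toSet _).image e)) hGZ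
  refine ⟨LinearMap.snd ℝ Y (ℕ →₀ ℝ) ∘ₗ P ∘ₗ LinearMap.inr ℝ Y (ℕ →₀ ℝ), fun f => ?_, ?_⟩
  · have h1 : ((0 : Y), sumSingle (Finset.range (N + N)) f) ∈ Z := by
      have h2 : ((0 : Y), sumSingle (Finset.range (N + N)) f) =
          ∑ i ∈ Finset.range (N + N), f i • e i := by
        ext1 <;> simp [e, sumSingle, Prod.fst_sum, Prod.snd_sum]
      rw [h2]
      exact sum_mem fun i hi => Submodule.smul_mem _ _ (heZ i (Finset.mem_range.1 hi))
    obtain ⟨h2, h3⟩ := hP.1 _ h1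
    have h4 : ((0 : Y), (P (0, sumSingle (Finset.range (N + N)) f)).2) =
        P (0, sumSingle (Finset.range (N + N)) f) := Prod.ext (hG _ h2).1.symm rfl
    change p (0, (P (0, sumSingle (Finset.range (N + N)) f)).2) ≤ _
    rw [h4]
    exact h3
  · change _ ≤ ∑ j ∈ Finset.range N, ∑ i ∈ Finset.range N,
        (|(P (e j)).2 (N + i)| + |(P (e (N + i))).2 j|)
    have h1 : ∀ j ∈ Finset.range N, 1 ≤ s * ∑ i ∈ Finset.range N,
        (|(P (e j)).2 (N + i)| + |(P (e (N + i))).2 j|) := by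
      intro j hj
      rw [Finset.mem_range] at hj
      have h2 : (P (e j)).2 j = s * ∑ i ∈ Finset.range N, H j i * (P (e j)).2 (N + i) := by
        have h3 := (hG _ (hP.1 _ (heZ j (by omega))).1).2
        rw [Finset.sum_congr rfl fun i hi => by rw [h3 i (Finset.mem_range.1 hi)]]
        have h4 : ∑ i ∈ Finset.range N, H j i * (s * ∑ l ∈ Finset.range N, H i l * (P (e j)).2 l) =
            s * ∑ l ∈ Finset.range N, (∑ i ∈ Finset.range N, H j i * H i l) * (P (e j)).2 l := by
          simp only [Finset.mul_sum, Finset.sum_mul]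
          rw [Finset.sum_comm]
          exact Finset.sum_congr rfl fun l _ => Finset.sum_congr rfl fun i _ => by ring
        rw [h4, Finset.sum_congr rfl fun l hl => by rw [hH j hj l (Finset.mem_range.1 hl)]]
        simp only [ite_mul, zero_mul]
        rw [Finset.sum_ite_eq, if_pos (Finset.mem_range.2 hj)]
        linear_combination -(P (e j)).2 j * hssN
      have h3 : (P (e j)).2 j + s * ∑ i ∈ Finset.range N, H i j * (P (e (N + i))).2 j = 1 := by
        have h4 : (P (g j)).2 j = 1 := by rw [hP.2 _ (hgG j hj), hg2' j hj j hj, if_pos rfl]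
        rw [← h4]
        simp only [g, map_add, map_sum, map_smul, Prod.snd_add, Prod.snd_sum, Prod.smul_snd,
          Finsupp.add_apply, Finsupp.finsetSum_apply, Finsupp.smul_apply, smul_eq_mul,
          Finset.mul_sum, mul_assoc]
      rw [h2, ← mul_add, ← Finset.sum_add_distrib] at h3
      rw [← h3]
      refine mul_le_mul_of_nonneg_left (Finset.sum_le_sum fun i _ => add_le_add ?_ ?_) hs0 <;>
      · refine (le_abs_self _).trans ?_
        rw [abs_mul]
        exact mul_le_of_le_one_left (abs_nonneg _) (hH1 _ _)
    have h2 := Finset.sum_le_sum h1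
    rw [Finset.sum_const, Finset.card_range, nsmul_eq_mul, mul_one, ← Finset.mul_sum] at h2
    have h3 := mul_le_mul_of_nonneg_right h2 (Real.sqrt_nonneg N)
    refine h3.trans_eq ?_
    rw [mul_right_comm, hsN, one_mul]

namespace IsUnconditionalSpreading

lemma apply_sumSingle_shift_le (hp : IsUnconditionalSpreading p B) (a : ℕ →₀ ℝ) (m N : ℕ) :
    p (0, sumSingle (Finset.range N) fun i => a (m + i)) ≤ p (0, a) := by
  have hσ : StrictMono fun i : ℕ => m + i := fun _ _ h => Nat.add_lt_add_left h m
  rw [← hp.apply_mapDomain hσ, ← sumSingle_range_map _ _ hσ]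
  refine hp.apply_le_of_contraction 0 fun i => ?_
  rw [sumSingle_apply]
  split_ifs
  · exact ⟨1, zero_le_one, le_rfl, by simp⟩
  · exact ⟨0, le_rfl, zero_le_one, by simp⟩

lemma sum_abs_shift_mul_le (hp : IsUnconditionalSpreading p B) (a : ℕ →₀ ℝ) (m N : ℕ) :
    (∑ i ∈ Finset.range N, |a (m + i)|) * fundamentalFunction p N ≤ 4 * N * p (0, a) :=
  (hp.sum_abs_mul_le N _).trans (by gcongr; exact hp.apply_sumSingle_shift_le a m N)

lemma fundamentalFunction_two_pow (hp : IsUnconditionalSpreading p B) (hΛ0 : 0 ≤ Λ)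
    (hΛ : UniformlyComplemented (V := Y × (ℕ →₀ ℝ)) p Λ) (k : ℕ) :
    fundamentalFunction p (2 ^ k) ≤ 8 * B * Λ * √(2 ^ k : ℕ) ∧
      √(2 ^ k : ℕ) ≤ 4 * Λ * fundamentalFunction p (2 ^ k) := by
  obtain ⟨T, hT, hN⟩ := hΛ.exists_operator_sum_abs_ge Nat.one_le_two_pow (abs_hadamard_le k)
    (hadamard_mul_self k)
  have hN1 : 1 ≤ 2 ^ k := Nat.one_le_two_pow
  generalize 2 ^ k = N at *
  have hN0 : (0 : ℝ) < N := by exact_mod_cast hN1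
  have hφ := hp.one_le_fundamentalFunction hN1
  simp only [Finset.sum_add_distrib] at hN
  rw [Finset.sum_comm (f := fun j i => |T (Finsupp.single (N + i) 1) j|)] at hN
  constructor
  · have h1 : ∀ j < N + N, ∀ m, (∑ i ∈ Finset.range N, |T (Finsupp.single j 1) (m + i)|) *
        fundamentalFunction p N ≤ 4 * N * (Λ * B) := by
      intro j hj m
      refine (hp.sum_abs_shift_mul_le _ m N).trans ?_
      have h2 := hT (Pi.single j 1)
      have h3 : sumSingle (Finset.range (N + N)) (Pi.single j 1) = Finsupp.single j 1 := by
        ext i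
        rw [sumSingle_apply, Finsupp.single_eq_pi_single]
        by_cases h : i = j
        · simp [h, hj]
        · simp [h]
      rw [h3, hp.apply_single, abs_one, one_mul] at h2
      have h4 : Λ * p (0, Finsupp.single 0 1) ≤ Λ * B := by gcongr; exact hp.le_bound
      gcongr
      exact h2.trans h4
    have h2 : (∑ j ∈ Finset.range N, ∑ i ∈ Finset.range N, |T (Finsupp.single j 1) (N + i)|) *
        fundamentalFunction p N ≤ N * (4 * N * (Λ * B)) := by
      rw [Finset.sum_mul]
      refine (Finset.sum_le_card_nsmul _ _ (4 * N * (Λ * B)) fun j hj => h1 j ?_ N).trans_eq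
        (by rw [Finset.card_range, nsmul_eq_mul])
      have := Finset.mem_range.1 hj
      omega
    have h3 : (∑ i ∈ Finset.range N, ∑ j ∈ Finset.range N, |T (Finsupp.single (N + i) 1) j|) *
        fundamentalFunction p N ≤ N * (4 * N * (Λ * B)) := by
      rw [Finset.sum_mul]
      refine (Finset.sum_le_card_nsmul _ _ (4 * N * (Λ * B)) fun j hj => ?_).trans_eq
        (by rw [Finset.card_range, nsmul_eq_mul])
      have := Finset.mem_range.1 hj
      simpa using h1 (N + j) (by omega) 0
    have h4 : N * √N * fundamentalFunction p N ≤ N * √N * (8 * B * Λ * √N) := by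
      calc N * √N * fundamentalFunction p N ≤ _ :=
            mul_le_mul_of_nonneg_right hN (by linarith)
        _ ≤ N * (8 * B * Λ) * N := by rw [add_mul]; linarith
        _ = _ := by
            nth_rewrite 2 [← Real.mul_self_sqrt hN0.le]; ring
    exact le_of_mul_le_mul_left h4 (mul_pos hN0 (Real.sqrt_pos.2 hN0))
  · have h1 : ∀ m ≤ N, ∀ l, ∑ j ∈ Finset.range N, |T (Finsupp.single (m + j) 1) l| ≤
        2 * Λ * fundamentalFunction p N := by
      intro m hm l
      have h2 : ∀ t : ℝ, ∃ ε : ℝ, |ε| ≤ 1 ∧ ε * t = |t| := by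
        intro t
        rcases le_total 0 t with h | h
        · exact ⟨1, by simp, by rw [abs_of_nonneg h, one_mul]⟩
        · exact ⟨-1, by simp, by rw [abs_of_nonpos h]; ring⟩
      choose ε hε1 hε using h2
      let f : ℕ → ℝ := fun i =>
        if i ∈ Finset.Ico m (m + N) then ε (T (Finsupp.single i 1) l) else 0
      have h3 : sumSingle (Finset.range (N + N)) f =
          ∑ j ∈ Finset.range N, ε (T (Finsupp.single (m + j) 1) l) • Finsupp.single (m + j) 1 := by
        have h4 : sumSingle (Finset.range (N + N)) f = sumSingle (Finset.Ico m (m + N)) f := by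
          ext i
          rw [sumSingle_apply, sumSingle_apply]
          simp only [f, Finset.mem_range, Finset.mem_Ico]
          split_ifs <;> first | rfl | omega
        rw [h4, sumSingle, Finset.sum_Ico_eq_sum_range, Nat.add_sub_cancel_left]
        refine Finset.sum_congr rfl fun j hj => ?_
        rw [Finsupp.smul_single_one]
        simp only [f]
        rw [if_pos (by have := Finset.mem_range.1 hj; simp [this])]
      have h4 : p (0, sumSingle (Finset.range (N + N)) f) ≤ 2 * fundamentalFunction p N := by
        have h5 := hp.apply_sumSingle_one (Finset.Ico m (m + N))
        rw [Nat.card_Ico, Nat.add_sub_cancel_left] at h5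
        rw [← h5]
        refine hp.apply_le_two_mul fun i => ?_
        rw [sumSingle_apply, sumSingle_apply]
        by_cases hi : i ∈ Finset.Ico m (m + N)
        · simp only [f, hi, if_true, abs_one]
          split_ifs <;> simp [hε1]
        · simp only [f, hi, if_false, ite_self, abs_zero, le_refl]
      have h5 : ∑ j ∈ Finset.range N, |T (Finsupp.single (m + j) 1) l| =
          T (sumSingle (Finset.range (N + N)) f) l := by
        rw [h3, map_sum, Finsupp.finsetSum_apply]
        refine Finset.sum_congr rfl fun j _ => ?_
        rw [map_smul, Finsupp.smul_apply, smul_eq_mul, hε]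
      rw [h5]
      refine (le_abs_self _).trans ((hp.abs_le _ l).trans ((hT f).trans ?_))
      calc Λ * p (0, sumSingle (Finset.range (N + N)) f) ≤ Λ * (2 * fundamentalFunction p N) := by
            gcongr
        _ = _ := by ring
    have h2 : ∑ j ∈ Finset.range N, ∑ i ∈ Finset.range N, |T (Finsupp.single j 1) (N + i)| ≤
        N * (2 * Λ * fundamentalFunction p N) := by
      rw [Finset.sum_comm]
      refine (Finset.sum_le_card_nsmul _ _ (2 * Λ * fundamentalFunction p N) fun i _ => ?_).trans_eq
        (by rw [Finset.card_range, nsmul_eq_mul])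
      simpa using h1 0 (Nat.zero_le N) (N + i)
    have h3 : ∑ i ∈ Finset.range N, ∑ j ∈ Finset.range N, |T (Finsupp.single (N + i) 1) j| ≤
        N * (2 * Λ * fundamentalFunction p N) := by
      rw [Finset.sum_comm]
      exact (Finset.sum_le_card_nsmul _ _ (2 * Λ * fundamentalFunction p N) fun j _ =>
        h1 N le_rfl j).trans_eq (by rw [Finset.card_range, nsmul_eq_mul])
    refine le_of_mul_le_mul_left ?_ hN0
    linarith

lemma fundamentalFunction_le (hp : IsUnconditionalSpreading p B) (hΛ0 : 0 ≤ Λ)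
    (hΛ : UniformlyComplemented (V := Y × (ℕ →₀ ℝ)) p Λ) (m : ℕ) :
    fundamentalFunction p m ≤ 16 * B * Λ * √m := by
  have hB : 0 ≤ B := zero_le_one.trans (hp.one_le.trans hp.le_bound)
  rcases Nat.eq_zero_or_pos m with rfl | hm
  · have : fundamentalFunction p 0 = 0 := by
      simp [fundamentalFunction, sumSingle, hp.apply_zero]
    simp [this]
  · obtain ⟨k, hk1, hk2⟩ : ∃ k, m ≤ 2 ^ k ∧ 2 ^ k ≤ 2 ^ 2 * m := by
      refine ⟨Nat.log 2 m + 1, (Nat.lt_pow_succ_log_self one_lt_two m).le, ?_⟩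
      have := Nat.pow_log_le_self 2 hm.ne'
      rw [pow_succ]
      omega
    have h1 : √(2 ^ k : ℕ) ≤ 2 * √m := by
      calc √(2 ^ k : ℕ) ≤ √(2 ^ 2 * m : ℝ) := Real.sqrt_le_sqrt (by exact_mod_cast hk2)
        _ = 2 * √m := by rw [Real.sqrt_mul (by positivity), Real.sqrt_sq (by norm_num)]
    calc fundamentalFunction p m ≤ fundamentalFunction p (2 ^ k) := hp.fundamentalFunction_mono hk1
      _ ≤ 8 * B * Λ * √(2 ^ k : ℕ) := (hp.fundamentalFunction_two_pow hΛ0 hΛ k).1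
      _ ≤ 8 * B * Λ * (2 * √m) := by gcongr
      _ = _ := by ring

end IsUnconditionalSpreading

end FundamentalFunctionBounds

section Rademacher

/-- The sum of the first `n` Rademacher functions with coefficients `a`, as a function on
`{0, …, 2 ^ n - 1}`. -/
def rademacherSum (a : ℕ → ℝ) : ℕ → ℕ → ℝ
  | 0, _ => 0
  | n + 1, ω => rademacherSum a n (ω % 2 ^ n) + if ω < 2 ^ n then a n else -a n

lemma rademacherSum_add (a b : ℕ → ℝ) (n ω : ℕ) :
    rademacherSum (a + b) n ω = rademacherSum a n ω + rademacherSum b n ω := by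
  induction n generalizing ω with
  | zero => simp [rademacherSum]
  | succ n ih =>
    simp only [rademacherSum, ih, Pi.add_apply]
    split_ifs <;> ring

lemma rademacherSum_smul (c : ℝ) (a : ℕ → ℝ) (n ω : ℕ) :
    rademacherSum (c • a) n ω = c * rademacherSum a n ω := by
  induction n generalizing ω with
  | zero => simp [rademacherSum]
  | succ n ih =>
    simp only [rademacherSum, ih, Pi.smul_apply, smul_eq_mul]
    split_ifs <;> ring

lemma sum_rademacherSum_succ (a : ℕ → ℝ) (n : ℕ) (F : ℝ → ℝ) :
    ∑ ω ∈ Finset.range (2 ^ (n + 1)), F (rademacherSum a (n + 1) ω) =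
      ∑ ω ∈ Finset.range (2 ^ n),
        (F (rademacherSum a n ω + a n) + F (rademacherSum a n ω - a n)) := by
  rw [show 2 ^ (n + 1) = 2 ^ n + 2 ^ n by ring, Finset.sum_range_add, ← Finset.sum_add_distrib]
  refine Finset.sum_congr rfl fun ω hω => ?_
  rw [Finset.mem_range] at hω
  simp [rademacherSum, Nat.mod_eq_of_lt hω, hω, sub_eq_add_neg]

lemma sum_rademacherSum_sq (a : ℕ → ℝ) (n : ℕ) :
    ∑ ω ∈ Finset.range (2 ^ n), rademacherSum a n ω ^ 2 =
      2 ^ n * ∑ i ∈ Finset.range n, a i ^ 2 := by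
  induction n with
  | zero => simp [rademacherSum]
  | succ n ih =>
    rw [sum_rademacherSum_succ a n fun t => t ^ 2, Finset.sum_range_succ]
    have h1 : ∀ t : ℝ, (t + a n) ^ 2 + (t - a n) ^ 2 = 2 * t ^ 2 + 2 * a n ^ 2 := fun t => by ring
    simp only [h1, Finset.sum_add_distrib, ← Finset.mul_sum, ih, Finset.sum_const,
      Finset.card_range, nsmul_eq_mul]
    push_cast
    ring

lemma sum_rademacherSum_pow_four_le (a : ℕ → ℝ) (n : ℕ) :
    ∑ ω ∈ Finset.range (2 ^ n), rademacherSum a n ω ^ 4 ≤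
      3 * 2 ^ n * (∑ i ∈ Finset.range n, a i ^ 2) ^ 2 := by
  induction n with
  | zero => simp [rademacherSum]
  | succ n ih =>
    rw [sum_rademacherSum_succ a n fun t => t ^ 4, Finset.sum_range_succ]
    have h1 : ∀ t : ℝ, (t + a n) ^ 4 + (t - a n) ^ 4 =
        2 * t ^ 4 + 12 * a n ^ 2 * t ^ 2 + 2 * a n ^ 4 := fun t => by ring
    simp only [h1, Finset.sum_add_distrib, ← Finset.mul_sum, sum_rademacherSum_sq, Finset.sum_const,
      Finset.card_range, nsmul_eq_mul]
    push_cast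
    have h2 : 0 ≤ (2 : ℝ) ^ n * a n ^ 4 := by positivity
    rw [pow_succ (2 : ℝ) n]
    nlinarith

lemma mul_sqrt_le_sum_abs_rademacherSum (a : ℕ → ℝ) (n : ℕ) :
    2 ^ n * √(∑ i ∈ Finset.range n, a i ^ 2) ≤
      8 * ∑ ω ∈ Finset.range (2 ^ n), |rademacherSum a n ω| := by
  have hs := Finset.sum_nonneg fun i (_ : i ∈ Finset.range n) => sq_nonneg (a i)
  have h2 := sum_rademacherSum_sq a n
  have h4 := sum_rademacherSum_pow_four_le a n
  generalize ∑ i ∈ Finset.range n, a i ^ 2 = s at *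
  rcases hs.eq_or_lt with rfl | hs
  · simpa using Finset.sum_nonneg fun i _ => abs_nonneg _
  have hσ : 0 < √s := Real.sqrt_pos.2 hs
  have hσs : √s ^ 2 = s := Real.sq_sqrt hs.le
  generalize √s = σ at *
  subst hσs
  have h5 : ∀ t : ℝ, 4 * σ ^ 2 * t ^ 2 ≤ 8 * σ ^ 3 * |t| + t ^ 4 := by
    intro t
    have h6 : t ^ 2 = |t| ^ 2 := (sq_abs t).symm
    have h7 : t ^ 4 = |t| ^ 4 := by rw [show t ^ 4 = (t ^ 2) ^ 2 by ring, h6]; ring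
    rw [h6, h7]
    have h8 := abs_nonneg t
    generalize |t| = u at *
    rcases le_total u (2 * σ) with h | h
    · have : 0 ≤ σ ^ 2 * u * (2 * σ - u) := by
        have := sub_nonneg.2 h
        positivity
      nlinarith [pow_nonneg h8 4]
    · have : 0 ≤ u ^ 2 * ((u - 2 * σ) * (u + 2 * σ)) := by
        have := sub_nonneg.2 h
        positivity
      have : 0 ≤ σ ^ 3 * u := by positivity
      nlinarith
  have h6 := Finset.sum_le_sum fun ω (_ : ω ∈ Finset.range (2 ^ n)) => h5 (rademacherSum a n ω)
  rw [← Finset.mul_sum, h2, Finset.sum_add_distrib, ← Finset.mul_sum] at h6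
  have h7 : σ ^ 3 * (2 ^ n * σ) ≤
      σ ^ 3 * (8 * ∑ ω ∈ Finset.range (2 ^ n), |rademacherSum a n ω|) := by nlinarith
  exact le_of_mul_le_mul_left h7 (by positivity)

lemma abs_le_sum_indicator {σ : ℝ} (hσ : 0 ≤ σ) {t : ℝ} {K : ℕ} (h : |t| ≤ K * σ) :
    |t| ≤ σ * ∑ m ∈ Finset.range K, if m * σ < |t| then 1 else 0 := by
  induction K with
  | zero => simpa using h
  | succ K ih =>
    rw [Finset.sum_range_succ]
    by_cases hK : |t| ≤ K * σ
    · refine (ih hK).trans (mul_le_mul_of_nonneg_left ?_ hσ)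
      split_ifs <;> simp
    · rw [not_le] at hK
      rw [Finset.sum_congr rfl fun m hm => if_pos (lt_of_le_of_lt ?_ hK), if_pos hK]
      · simp only [Finset.sum_const, Finset.card_range, nsmul_eq_mul, mul_one]
        push_cast at h
        linarith
      · have : (m : ℝ) ≤ K := by exact_mod_cast (Finset.mem_range.1 hm).le
        gcongr

variable {Y : Type*} [NormedAddCommGroup Y] [NormedSpace ℝ Y]
  {p : Seminorm ℝ (Y × (ℕ →₀ ℝ))} {B Λ : ℝ}

lemma card_filter_lt_abs_rademacherSum (a : ℕ → ℝ) (n m : ℕ)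
    (hs : 0 < ∑ i ∈ Finset.range n, a i ^ 2) :
    √(((Finset.range (2 ^ n)).filter fun ω =>
        m * √(∑ i ∈ Finset.range n, a i ^ 2) < |rademacherSum a n ω|).card : ℝ) ≤
      12 * √(2 ^ n : ℕ) * (1 / (m + 1) - 1 / ((m + 1 : ℕ) + 1)) := by
  have h4 := sum_rademacherSum_pow_four_le a n
  generalize ∑ i ∈ Finset.range n, a i ^ 2 = s at *
  have hσ : 0 < √s := Real.sqrt_pos.2 hs
  have hσs : √s ^ 2 = s := Real.sq_sqrt hs.le
  generalize √s = σ at *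
  subst hσs
  set A := (Finset.range (2 ^ n)).filter fun ω => m * σ < |rademacherSum a n ω| with hA
  have h1 : (A.card : ℝ) ≤ 2 ^ n := by
    have := Finset.card_filter_le (Finset.range (2 ^ n)) fun ω => m * σ < |rademacherSum a n ω|
    rw [Finset.card_range] at this
    exact_mod_cast this
  have h2 : (A.card : ℝ) * m ^ 4 ≤ 3 * 2 ^ n := by
    have h3 : A.card • (m * σ) ^ 4 ≤ ∑ ω ∈ A, rademacherSum a n ω ^ 4 := by
      refine Finset.card_nsmul_le_sum _ _ _ fun ω hω => ?_
      have := (Finset.mem_filter.1 hω).2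
      calc (m * σ) ^ 4 ≤ |rademacherSum a n ω| ^ 4 := by gcongr
        _ = _ := by rw [pow_abs, abs_of_nonneg (by positivity)]
    have h5 : ∑ ω ∈ A, rademacherSum a n ω ^ 4 ≤
        ∑ ω ∈ Finset.range (2 ^ n), rademacherSum a n ω ^ 4 :=
      Finset.sum_le_sum_of_subset_of_nonneg (Finset.filter_subset _ _) fun _ _ _ => by positivity
    rw [nsmul_eq_mul] at h3
    have h6 : σ ^ 4 * ((A.card : ℝ) * m ^ 4) ≤ σ ^ 4 * (3 * 2 ^ n) := by linarith
    exact le_of_mul_le_mul_left h6 (by positivity)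
  have h3 : (1 : ℝ) / (m + 1) - 1 / ((m + 1 : ℕ) + 1) = 1 / ((m + 1) * (m + 2)) := by
    push_cast; field_simp; ring
  have h5 : (A.card : ℝ) * ((m + 1) * (m + 2)) ^ 2 ≤ 144 * 2 ^ n := by
    rcases Nat.eq_zero_or_pos m with rfl | hm
    · norm_num; linarith
    · have hm1 : (1 : ℝ) ≤ m := by exact_mod_cast hm
      have h6 : ((m : ℝ) + 1) * (m + 2) ≤ 6 * m ^ 2 := by nlinarith
      calc (A.card : ℝ) * (((m : ℝ) + 1) * (m + 2)) ^ 2 ≤ (A.card : ℝ) * (6 * (m : ℝ) ^ 2) ^ 2 := by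
            gcongr
        _ = 36 * ((A.card : ℝ) * (m : ℝ) ^ 4) := by ring
        _ ≤ 144 * 2 ^ n := by nlinarith [pow_pos (two_pos (α := ℝ)) n]
  rw [h3, mul_one_div, le_div_iff₀ (by positivity)]
  refine abs_le_of_sq_le_sq' ?_ (by positivity) |>.2
  rw [mul_pow, mul_pow (12 : ℝ), Real.sq_sqrt (by positivity), Real.sq_sqrt (by positivity)]
  push_cast
  linarith

namespace IsUnconditionalSpreading

lemma apply_rademacherSum_le (hp : IsUnconditionalSpreading p B) (hΛ0 : 0 ≤ Λ)
    (hΛ : UniformlyComplemented (V := Y × (ℕ →₀ ℝ)) p Λ) (a : ℕ → ℝ) (n : ℕ) :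
    p (0, sumSingle (Finset.range (2 ^ n)) (rademacherSum a n)) ≤
      384 * B * Λ * √(∑ i ∈ Finset.range n, a i ^ 2) * √(2 ^ n : ℕ) := by
  have hB : 0 ≤ B := zero_le_one.trans (hp.one_le.trans hp.le_bound)
  have hs := Finset.sum_nonneg fun i (_ : i ∈ Finset.range n) => sq_nonneg (a i)
  have hcard := card_filter_lt_abs_rademacherSum a n
  have h2 := sum_rademacherSum_sq a n
  generalize ∑ i ∈ Finset.range n, a i ^ 2 = s at *
  rcases hs.eq_or_lt with rfl | hs
  · rw [mul_zero, Finset.sum_eq_zero_iff_of_nonneg fun _ _ => sq_nonneg _] at h2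
    have h3 : sumSingle (Finset.range (2 ^ n)) (rademacherSum a n) = 0 :=
      Finset.sum_eq_zero fun i hi => by rw [pow_eq_zero_iff two_ne_zero |>.1 (h2 i hi)]; simp
    rw [h3, hp.apply_zero]
    simp
  replace hcard := fun m => hcard m hs
  have hσ : 0 < √s := Real.sqrt_pos.2 hs
  generalize √s = σ at *
  obtain ⟨K, hK⟩ : ∃ K : ℕ, ∀ ω ∈ Finset.range (2 ^ n), |rademacherSum a n ω| ≤ K * σ := by
    obtain ⟨K, hK⟩ := exists_nat_ge ((∑ ω ∈ Finset.range (2 ^ n), |rademacherSum a n ω|) / σ)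
    rw [div_le_iff₀ hσ] at hK
    exact ⟨K, fun ω hω => (Finset.single_le_sum (f := fun ω => |rademacherSum a n ω|)
      (fun _ _ => abs_nonneg _) hω).trans hK⟩
  let A : ℕ → Finset ℕ := fun m =>
    (Finset.range (2 ^ n)).filter fun ω => m * σ < |rademacherSum a n ω|
  have h3 : p (0, sumSingle (Finset.range (2 ^ n)) (rademacherSum a n)) ≤
      2 * p (0, σ • ∑ m ∈ Finset.range K, sumSingle (A m) fun _ => 1) := by
    refine hp.apply_le_two_mul fun ω => ?_
    rw [sumSingle_apply]
    split_ifs with hω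
    · have h4 : (σ • ∑ m ∈ Finset.range K, sumSingle (A m) fun _ => 1) ω =
          σ * ∑ m ∈ Finset.range K, if m * σ < |rademacherSum a n ω| then 1 else 0 := by
        rw [Finsupp.smul_apply, Finsupp.finsetSum_apply, smul_eq_mul]
        simp only [sumSingle_apply, A, Finset.mem_filter, hω, true_and]
      rw [h4]
      exact (abs_le_sum_indicator hσ.le (hK ω hω)).trans (le_abs_self _)
    · rw [abs_zero]; exact abs_nonneg _
  have h4 : p (0, σ • ∑ m ∈ Finset.range K, sumSingle (A m) fun _ => 1) ≤
      σ * ∑ m ∈ Finset.range K, fundamentalFunction p (A m).card := by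
    have h5 : ((0 : Y), σ • ∑ m ∈ Finset.range K, sumSingle (A m) fun _ => 1) =
        σ • ∑ m ∈ Finset.range K, ((0 : Y), sumSingle (A m) fun _ => 1) := by
      ext1 <;> simp [Prod.fst_sum, Prod.snd_sum]
    rw [h5, map_smul_eq_mul, Real.norm_of_nonneg hσ.le]
    gcongr
    refine (Finset.le_sum_of_subadditive p (map_zero p).le (map_add_le_add p) _ _).trans_eq ?_
    exact Finset.sum_congr rfl fun m _ => hp.apply_sumSingle_one (A m)
  have h5 : ∑ m ∈ Finset.range K, fundamentalFunction p (A m).card ≤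
      16 * B * Λ * (12 * √(2 ^ n : ℕ)) := by
    calc ∑ m ∈ Finset.range K, fundamentalFunction p (A m).card
        ≤ ∑ m ∈ Finset.range K, 16 * B * Λ *
          (12 * √(2 ^ n : ℕ) * (1 / (m + 1) - 1 / ((m + 1 : ℕ) + 1))) := by
          refine Finset.sum_le_sum fun m _ => (hp.fundamentalFunction_le hΛ0 hΛ _).trans ?_
          exact mul_le_mul_of_nonneg_left (hcard m) (by positivity)
      _ = 16 * B * Λ * (12 * √(2 ^ n : ℕ) * (1 / ((0 : ℕ) + 1) - 1 / (K + 1))) := by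
          rw [← Finset.mul_sum, ← Finset.mul_sum,
            Finset.sum_range_sub' fun m : ℕ => (1 : ℝ) / (m + 1)]
      _ ≤ 16 * B * Λ * (12 * √(2 ^ n : ℕ)) := by
          refine mul_le_mul_of_nonneg_left (mul_le_of_le_one_right (by positivity) ?_)
            (by positivity)
          have : (0 : ℝ) ≤ 1 / (K + 1) := by positivity
          simp only [Nat.cast_zero, zero_add, div_one]
          linarith
  calc p (0, sumSingle (Finset.range (2 ^ n)) (rademacherSum a n))
      ≤ 2 * (σ * (16 * B * Λ * (12 * √(2 ^ n : ℕ)))) := by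
        refine h3.trans (mul_le_mul_of_nonneg_left (h4.trans ?_) zero_le_two)
        exact mul_le_mul_of_nonneg_left h5 hσ.le
    _ = _ := by ring

lemma le_apply_rademacherSum (hp : IsUnconditionalSpreading p B) (hΛ0 : 0 ≤ Λ)
    (hΛ : UniformlyComplemented (V := Y × (ℕ →₀ ℝ)) p Λ) (a : ℕ → ℝ) (n : ℕ) :
    √(∑ i ∈ Finset.range n, a i ^ 2) * √(2 ^ n : ℕ) ≤
      128 * Λ * p (0, sumSingle (Finset.range (2 ^ n)) (rademacherSum a n)) := by
  have h1 := hp.sum_abs_mul_le (2 ^ n) (rademacherSum a n)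
  have h2 := (hp.fundamentalFunction_two_pow hΛ0 hΛ n).2
  have h3 := mul_sqrt_le_sum_abs_rademacherSum a n
  have hu0 := Finset.sum_nonneg fun ω (_ : ω ∈ Finset.range (2 ^ n)) =>
    abs_nonneg (rademacherSum a n ω)
  generalize ∑ ω ∈ Finset.range (2 ^ n), |rademacherSum a n ω| = u at *
  generalize √(∑ i ∈ Finset.range n, a i ^ 2) = σ at *
  generalize p (0, sumSingle (Finset.range (2 ^ n)) (rademacherSum a n)) = q at *
  have hM : (0 : ℝ) < 2 ^ n := by positivity
  have hφ := (zero_le_one).trans (hp.one_le_fundamentalFunction (Nat.one_le_two_pow (n := n)))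
  have hu : σ * 2 ^ n ≤ 8 * u := by linarith
  push_cast at *
  have hsq := Real.sqrt_nonneg ((2 : ℝ) ^ n)
  refine le_of_mul_le_mul_left ?_ hM
  generalize √((2 : ℝ) ^ n) = r at *
  generalize fundamentalFunction p (2 ^ n) = f at *
  generalize (2 : ℝ) ^ n = M at *
  calc M * (σ * r) = σ * M * r := by ring
    _ ≤ 8 * u * r := by gcongr
    _ ≤ 8 * u * (4 * Λ * f) := by gcongr
    _ = 32 * Λ * (u * f) := by ring
    _ ≤ 32 * Λ * (4 * M * q) := by gcongr
    _ = _ := by ring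

/-- The seminorm contains uniformly isomorphic copies of Euclidean spaces. -/
lemma exists_euclidean_map (hp : IsUnconditionalSpreading p B) (hΛ0 : 0 ≤ Λ)
    (hΛ : UniformlyComplemented (V := Y × (ℕ →₀ ℝ)) p Λ) (n : ℕ) :
    ∃ (R : (ℕ → ℝ) →ₗ[ℝ] (ℕ →₀ ℝ)) (F : Submodule ℝ (ℕ →₀ ℝ)), F.FG ∧ ∀ a, R a ∈ F ∧
      √(∑ i ∈ Finset.range n, a i ^ 2) ≤ 128 * Λ * p (0, R a) ∧
      p (0, R a) ≤ 384 * B * Λ * √(∑ i ∈ Finset.range n, a i ^ 2) := by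
  classical
  have hM : 0 < √(2 ^ n : ℕ) := Real.sqrt_pos.2 (by positivity)
  set r := √(2 ^ n : ℕ) with hr
  let R : (ℕ → ℝ) →ₗ[ℝ] (ℕ →₀ ℝ) :=
    { toFun := fun a => r⁻¹ • sumSingle (Finset.range (2 ^ n)) (rademacherSum a n)
      map_add' := fun a b => by
        rw [← smul_add, sumSingle, sumSingle, sumSingle, ← Finset.sum_add_distrib]
        simp only [rademacherSum_add, Finsupp.single_add]
      map_smul' := fun c a => by
        rw [RingHom.id_apply, smul_comm c, sumSingle, sumSingle, Finset.smul_sum (r := c)]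
        simp only [rademacherSum_smul, Finsupp.smul_single, smul_eq_mul] }
  have hR : ∀ a, p (0, R a) =
      r⁻¹ * p (0, sumSingle (Finset.range (2 ^ n)) (rademacherSum a n)) := by
    intro a
    have h1 : ((0 : Y), R a) =
        r⁻¹ • ((0 : Y), sumSingle (Finset.range (2 ^ n)) (rademacherSum a n)) := by
      rw [Prod.smul_mk, smul_zero]
      rfl
    rw [h1, map_smul_eq_mul, Real.norm_of_nonneg (by positivity)]
  refine ⟨R, Submodule.span ℝ ((fun i => Finsupp.single i 1) '' Finset.range (2 ^ n)),
    Submodule.fg_span ((Finset.finite_toSet _).image _), fun a => ⟨?_, ?_, ?_⟩⟩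
  · refine Submodule.smul_mem _ _ (sum_mem fun i hi => ?_)
    rw [← Finsupp.smul_single_one]
    exact Submodule.smul_mem _ _ (Submodule.subset_span ⟨i, hi, rfl⟩)
  · rw [hR]
    have h1 := hp.le_apply_rademacherSum hΛ0 hΛ a n
    rw [← hr, ← le_div_iff₀ hM] at h1
    exact h1.trans_eq (by rw [div_eq_inv_mul]; ring)
  · rw [hR, inv_mul_le_iff₀ hM]
    exact (hp.apply_rademacherSum_le hΛ0 hΛ a n).trans_eq (by rw [← hr]; ring)

end IsUnconditionalSpreading

end Rademacher

section EuclideanForms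

variable {Y : Type*} [NormedAddCommGroup Y] [NormedSpace ℝ Y]

/-- On `E` the norm is `√D`-equivalent to a Euclidean norm. -/
def EuclideanBound (E : Submodule ℝ Y) (D : ℝ) : Prop :=
  ∃ (m : ℕ) (S : Y →ₗ[ℝ] ℕ → ℝ), ∀ x ∈ E,
    ‖x‖ ^ 2 ≤ ∑ i ∈ Finset.range m, S x i ^ 2 ∧ ∑ i ∈ Finset.range m, S x i ^ 2 ≤ D * ‖x‖ ^ 2

lemma exists_euclideanBound {E : Submodule ℝ Y} (hE : E.FG) : ∃ D, 0 < D ∧ EuclideanBound E D := by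
  have : FiniteDimensional ℝ E := Module.Finite.iff_fg.2 hE
  let e : E ≃L[ℝ] EuclideanSpace ℝ (Fin (Module.finrank ℝ E)) := toEuclidean
  set C : ℝ := ‖(e.symm : EuclideanSpace ℝ (Fin (Module.finrank ℝ E)) →L[ℝ] E)‖ + 1
  let f : E →ₗ[ℝ] ℕ → ℝ := LinearMap.pi fun i =>
    if h : i < Module.finrank ℝ E then
      C • (EuclideanSpace.proj (𝕜 := ℝ) (⟨i, h⟩ : Fin (Module.finrank ℝ E))).toLinearMap ∘ₗ
        e.toLinearMap
    else 0
  obtain ⟨S, hS⟩ := LinearMap.exists_extend f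
  have hsum : ∀ x : E, ∑ i ∈ Finset.range (Module.finrank ℝ E), S x i ^ 2 = (C * ‖e x‖) ^ 2 := by
    intro x
    have h1 : S x = f x := LinearMap.congr_fun hS x
    rw [h1, Finset.sum_range, mul_pow, EuclideanSpace.real_norm_sq_eq, Finset.mul_sum]
    refine Finset.sum_congr rfl fun i _ => ?_
    have h2 : f x i = C * e x i := by simp [f]
    rw [h2, mul_pow]
  set C' : ℝ := ‖(e : E →L[ℝ] EuclideanSpace ℝ (Fin (Module.finrank ℝ E)))‖ + 1
  have hC : 0 < C := by positivity
  have hC' : 0 < C' := by positivity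
  refine ⟨(C * C') ^ 2, by positivity, Module.finrank ℝ E, S, fun x hx => ?_⟩
  rw [hsum ⟨x, hx⟩, ← mul_pow]
  have h1 : ‖x‖ ≤ C * ‖e ⟨x, hx⟩‖ := by
    have := (e.symm : EuclideanSpace ℝ (Fin (Module.finrank ℝ E)) →L[ℝ] E).le_opNorm (e ⟨x, hx⟩)
    rw [ContinuousLinearEquiv.coe_coe, e.symm_apply_apply] at this
    refine this.trans (mul_le_mul_of_nonneg_right ?_ (norm_nonneg _))
    simp [C]
  have h2 : ‖e ⟨x, hx⟩‖ ≤ C' * ‖x‖ := by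
    have := (e : E →L[ℝ] EuclideanSpace ℝ (Fin (Module.finrank ℝ E))).le_opNorm ⟨x, hx⟩
    refine this.trans (mul_le_mul_of_nonneg_right ?_ (norm_nonneg x))
    simp [C']
  constructor
  · gcongr
  · have h3 : C * ‖e ⟨x, hx⟩‖ ≤ C * C' * ‖x‖ := by rw [mul_assoc]; gcongr
    gcongr

lemma EuclideanBound.mono {E : Submodule ℝ Y} {D D' : ℝ} (h : EuclideanBound E D) (hD : D ≤ D') :
    EuclideanBound E D' := by
  obtain ⟨m, S, hS⟩ := h
  exact ⟨m, S, fun x hx => ⟨(hS x hx).1, (hS x hx).2.trans (by gcongr)⟩⟩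

/-- Projecting onto the graph of a multiple of a Euclidean embedding improves the embedding. -/
lemma EuclideanBound.improve {p : Seminorm ℝ (Y × (ℕ →₀ ℝ))} {B Λ α β D : ℝ}
    (hp : IsUnconditionalSpreading p B) (hΛ0 : 0 ≤ Λ)
    (hΛ : UniformlyComplemented (V := Y × (ℕ →₀ ℝ)) p Λ) (hα : 0 ≤ α)
    (hR : ∀ n, ∃ (R : (ℕ → ℝ) →ₗ[ℝ] (ℕ →₀ ℝ)) (F : Submodule ℝ (ℕ →₀ ℝ)), F.FG ∧ ∀ a, R a ∈ F ∧
      √(∑ i ∈ Finset.range n, a i ^ 2) ≤ α * p (0, R a) ∧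
      p (0, R a) ≤ β * √(∑ i ∈ Finset.range n, a i ^ 2))
    {E : Submodule ℝ Y} (hE : E.FG) (hD : 0 < D) (h : EuclideanBound E D) :
    EuclideanBound E (2 * Λ ^ 2 * (4 * α ^ 2 + β ^ 2) * √D) := by
  obtain ⟨m, S, hS⟩ := h
  obtain ⟨R, F, hF, hR⟩ := hR m
  have hsD : 0 < √D := Real.sqrt_pos.2 hD
  set t : ℝ := √((√D)⁻¹) with ht
  have ht0 : 0 < t := Real.sqrt_pos.2 (inv_pos.2 hsD)
  have ht2 : t ^ 2 = (√D)⁻¹ := Real.sq_sqrt (inv_pos.2 hsD).le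
  let L : Y →ₗ[ℝ] Y × (ℕ →₀ ℝ) := LinearMap.prod LinearMap.id (t • R ∘ₗ S)
  have hL : ∀ x, L x = (x, t • R (S x)) := fun x => rfl
  let Z : Submodule ℝ (Y × (ℕ →₀ ℝ)) :=
    E.map (LinearMap.inl ℝ Y (ℕ →₀ ℝ)) ⊔ F.map (LinearMap.inr ℝ Y (ℕ →₀ ℝ))
  have hxZ : ∀ x ∈ E, (x, (0 : ℕ →₀ ℝ)) ∈ Z := fun x hx =>
    Submodule.mem_sup_left (Submodule.mem_map_of_mem (f := LinearMap.inl ℝ Y (ℕ →₀ ℝ)) hx)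
  have haZ : ∀ a, ((0 : Y), R a) ∈ Z := fun a =>
    Submodule.mem_sup_right (Submodule.mem_map_of_mem (f := LinearMap.inr ℝ Y (ℕ →₀ ℝ)) (hR a).1)
  have hLadd : ∀ x, L x = (x, 0) + t • (0, R (S x)) := fun x => by simp [hL]
  have hGZ : E.map L ≤ Z := by
    rintro _ ⟨x, hx, rfl⟩
    rw [hLadd]
    exact add_mem (hxZ x hx) (Submodule.smul_mem _ _ (haZ _))
  obtain ⟨P, hP⟩ := hΛ (E.map L) Z (hE.map L) ((hE.map _).sup (hF.map _)) hGZ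
  let A : Y →ₗ[ℝ] Y := LinearMap.fst ℝ Y (ℕ →₀ ℝ) ∘ₗ P ∘ₗ LinearMap.inl ℝ Y (ℕ →₀ ℝ)
  have hA : ∀ x, A x = (P (x, 0)).1 := fun x => rfl
  have hSA : ∀ x ∈ E, √(∑ i ∈ Finset.range m, S (A x) i ^ 2) ≤ 2 * α * Λ / t * ‖x‖ ∧ A x ∈ E := by
    intro x hx
    obtain ⟨⟨x', hx', hPx⟩, hle⟩ := hP.1 _ (hxZ x hx)
    have h1 : A x = x' := by rw [hA, ← hPx]; rfl
    rw [h1]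
    refine ⟨?_, hx'⟩
    rw [← hPx, hL, hp.apply_zero] at hle
    have h2 := hp.apply_zero_le x' (t • R (S x'))
    have h3 : p (0, t • R (S x')) = t * p (0, R (S x')) := by
      rw [show ((0 : Y), t • R (S x')) = t • (0, R (S x')) by simp, map_smul_eq_mul,
        Real.norm_of_nonneg ht0.le]
    rw [div_mul_eq_mul_div, le_div_iff₀ ht0]
    calc √(∑ i ∈ Finset.range m, S x' i ^ 2) * t ≤ α * p (0, R (S x')) * t := by
          gcongr; exact (hR _).2.1
      _ = α * (t * p (0, R (S x'))) := by ring
      _ ≤ α * (2 * (Λ * ‖x‖)) := mul_le_mul_of_nonneg_left (by linarith) hα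
      _ = _ := by ring
  have hB : ∀ a, ‖(P (0, R a)).1‖ ≤ Λ * β * √(∑ i ∈ Finset.range m, a i ^ 2) := by
    intro a
    have h1 := (hP.1 _ (haZ a)).2
    have h2 := hp.norm_le (P (0, R a)).1 (P (0, R a)).2
    calc ‖(P (0, R a)).1‖ ≤ Λ * p (0, R a) := h2.trans h1
      _ ≤ Λ * (β * √(∑ i ∈ Finset.range m, a i ^ 2)) := by gcongr; exact (hR a).2.2
      _ = _ := by ring
  let S' : Y →ₗ[ℝ] ℕ → ℝ := LinearMap.pi fun i =>
    if i < m then √2 • LinearMap.proj i ∘ₗ S ∘ₗ A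
    else (√2 * t * Λ * β) • LinearMap.proj (i - m) ∘ₗ S
  have hS' : ∀ x, ∑ i ∈ Finset.range (m + m), S' x i ^ 2 =
      2 * ∑ i ∈ Finset.range m, S (A x) i ^ 2 +
        2 * (t * Λ * β) ^ 2 * ∑ i ∈ Finset.range m, S x i ^ 2 := by
    intro x
    rw [Finset.sum_range_add, Finset.mul_sum, Finset.mul_sum]
    congr 1
    · refine Finset.sum_congr rfl fun i hi => ?_
      have h1 : S' x i = √2 * S (A x) i := by simp [S', Finset.mem_range.1 hi]
      rw [h1, mul_pow, Real.sq_sqrt zero_le_two]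
    · refine Finset.sum_congr rfl fun i hi => ?_
      have h1 : S' x (m + i) = √2 * t * Λ * β * S x i := by simp [S']
      rw [h1]
      linear_combination (t * Λ * β * S x i) ^ 2 * Real.sq_sqrt (zero_le_two (α := ℝ))
  refine ⟨m + m, S', fun x hx => ?_⟩
  rw [hS']
  obtain ⟨h1, hAE⟩ := hSA x hx
  have h2 := (hS x hx).2
  have h3 := (hS _ hAE).1
  have h4 : x = A x + t • (P (0, R (S x))).1 := by
    have h5 := congrArg Prod.fst (hP.2 _ (Submodule.mem_map_of_mem (f := L) hx))
    rw [hLadd, map_add, map_smul, ← hLadd] at h5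
    exact h5.symm
  have h5 : ‖x‖ ≤ ‖A x‖ + t * (Λ * β * √(∑ i ∈ Finset.range m, S x i ^ 2)) := by
    conv_lhs => rw [h4]
    refine (norm_add_le _ _).trans ?_
    rw [norm_smul, Real.norm_of_nonneg ht0.le]
    gcongr
    exact hB _
  have hq0 : 0 ≤ ∑ i ∈ Finset.range m, S (A x) i ^ 2 := Finset.sum_nonneg fun _ _ => sq_nonneg _
  have hr0 : 0 ≤ ∑ i ∈ Finset.range m, S x i ^ 2 := Finset.sum_nonneg fun _ _ => sq_nonneg _
  have hq := Real.sq_sqrt hq0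
  have hr := Real.sq_sqrt hr0
  have hq1 := Real.sqrt_nonneg (∑ i ∈ Finset.range m, S (A x) i ^ 2)
  have hr1 := Real.sqrt_nonneg (∑ i ∈ Finset.range m, S x i ^ 2)
  generalize √(∑ i ∈ Finset.range m, S (A x) i ^ 2) = q at *
  generalize √(∑ i ∈ Finset.range m, S x i ^ 2) = r at *
  rw [← hq, ← hr]
  rw [← hq] at h3
  rw [← hr] at h2
  constructor
  · have h6 : ‖x‖ ^ 2 ≤ (‖A x‖ + t * (Λ * β * r)) ^ 2 := by gcongr
    nlinarith [sq_nonneg (‖A x‖ - t * (Λ * β * r))]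
  · have h6 : q ^ 2 ≤ (2 * α * Λ / t * ‖x‖) ^ 2 := by gcongr
    have h7 : (2 * α * Λ / t * ‖x‖) ^ 2 = 4 * α ^ 2 * Λ ^ 2 * √D * ‖x‖ ^ 2 := by
      rw [mul_pow, div_pow, ht2, div_inv_eq_mul]; ring
    have h8 : (t * Λ * β) ^ 2 * r ^ 2 ≤ Λ ^ 2 * β ^ 2 * √D * ‖x‖ ^ 2 := by
      calc (t * Λ * β) ^ 2 * r ^ 2 ≤ (t * Λ * β) ^ 2 * (D * ‖x‖ ^ 2) := by gcongr
        _ = Λ ^ 2 * β ^ 2 * ((√D)⁻¹ * D) * ‖x‖ ^ 2 := by rw [mul_pow, mul_pow, ht2]; ring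
        _ = _ := by
          congr 2
          rw [inv_mul_eq_div, div_eq_iff hsD.ne', Real.mul_self_sqrt hD.le]
    rw [h7] at h6
    linarith

lemma EuclideanBound.of_improve {E : Submodule ℝ Y} (hE : E.FG) {K : ℝ} (hK : 0 < K)
    (h : ∀ D, 0 < D → EuclideanBound E D → EuclideanBound E (K * √D)) :
    EuclideanBound E (K ^ 2 + 1) := by
  let s : Set ℝ := {D | 0 < D ∧ EuclideanBound E D}
  have hne : s.Nonempty := exists_euclideanBound hE
  have hbdd : BddBelow s := ⟨0, fun D hD => hD.1.le⟩
  have h0 : 0 ≤ sInf s := le_csInf hne fun D hD => hD.1.le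
  have h1 : ∀ D ∈ s, sInf s ^ 2 / K ^ 2 ≤ D := by
    intro D hD
    have h2 : sInf s ≤ K * √D :=
      csInf_le hbdd ⟨mul_pos hK (Real.sqrt_pos.2 hD.1), h D hD.1 hD.2⟩
    rw [div_le_iff₀ (by positivity)]
    calc sInf s ^ 2 ≤ (K * √D) ^ 2 := by gcongr
      _ = D * K ^ 2 := by rw [mul_pow, Real.sq_sqrt hD.1.le]; ring
  have h2 := le_csInf hne h1
  rw [div_le_iff₀ (by positivity)] at h2
  have h3 : sInf s ≤ K ^ 2 := by
    rcases h0.eq_or_lt with h0 | h0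
    · rw [← h0]; positivity
    · refine le_of_mul_le_mul_left ?_ h0
      rwa [sq] at h2
  obtain ⟨D, hD, hlt⟩ := exists_lt_of_csInf_lt hne (h3.trans_lt (lt_add_one (K ^ 2)))
  exact hD.2.mono hlt.le

lemma isomorphicToHilbert_of_euclideanBound {D : ℝ}
    (h : ∀ E : Submodule ℝ Y, E.FG → EuclideanBound E D) : IsomorphicToHilbert Y := by
  classical
  choose m S hS using fun s : Finset Y => h (Submodule.span ℝ (s : Set Y)) ⟨s, rfl⟩
  let U : Ultrafilter (Finset Y) := Ultrafilter.of atTop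
  let q : Y → Y → Finset Y → ℝ := fun x y s =>
    if x ∈ Submodule.span ℝ (s : Set Y) ∧ y ∈ Submodule.span ℝ (s : Set Y) then
      ∑ i ∈ Finset.range (m s), S s x i * S s y i else 0
  have hmem : ∀ x, ∀ᶠ s : Finset Y in (U : Filter (Finset Y)), x ∈ Submodule.span ℝ (s : Set Y) := by
    intro x
    refine Ultrafilter.of_le atTop ?_
    filter_upwards [eventually_ge_atTop {x}] with s hs
    exact Submodule.subset_span (by simpa using hs)
  have hq : ∀ x y, ∀ᶠ s : Finset Y in (U : Filter (Finset Y)),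
      q x y s = ∑ i ∈ Finset.range (m s), S s x i * S s y i := by
    intro x y
    filter_upwards [hmem x, hmem y] with s hx hy
    exact if_pos ⟨hx, hy⟩
  have hbound : ∀ x y s, |q x y s| ≤ |D| * (‖x‖ ^ 2 + ‖y‖ ^ 2) := by
    intro x y s
    simp only [q]
    split_ifs with hxy
    · have h1 := (hS s x hxy.1).2
      have h2 := (hS s y hxy.2).2
      have h3 : |∑ i ∈ Finset.range (m s), S s x i * S s y i| ≤
          ∑ i ∈ Finset.range (m s), (S s x i ^ 2 + S s y i ^ 2) := by
        refine (Finset.abs_sum_le_sum_abs _ _).trans (Finset.sum_le_sum fun i _ => ?_)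
        rw [abs_le]
        constructor <;> nlinarith [sq_nonneg (S s x i + S s y i), sq_nonneg (S s x i - S s y i),
          sq_nonneg (S s x i), sq_nonneg (S s y i)]
      rw [Finset.sum_add_distrib] at h3
      have h4 := mul_le_mul_of_nonneg_right (le_abs_self D) (sq_nonneg ‖x‖)
      have h5 := mul_le_mul_of_nonneg_right (le_abs_self D) (sq_nonneg ‖y‖)
      linarith
    · rw [abs_zero]; positivity
  choose f hf using fun x y => exists_tendsto_ultrafilter U (q x y) 0
    (|D| * (‖x‖ ^ 2 + ‖y‖ ^ 2)) fun s => by rw [Real.dist_eq, sub_zero]; exact hbound x y s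
  have hle : ∀ x, 1 * ‖x‖ ^ 2 ≤ f x x ∧ f x x ≤ (|D| + 1) * ‖x‖ ^ 2 := by
    intro x
    constructor
    · refine ge_of_tendsto (hf x x) ?_
      filter_upwards [hq x x, hmem x] with s hs hx
      rw [hs, one_mul]
      simpa only [sq] using (hS s x hx).1
    · refine le_of_tendsto (hf x x) ?_
      filter_upwards [hq x x, hmem x] with s hs hx
      rw [hs]
      have h1 : (D : ℝ) * ‖x‖ ^ 2 ≤ (|D| + 1) * ‖x‖ ^ 2 := by
        gcongr; linarith [le_abs_self D]
      refine le_trans ?_ h1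
      simpa only [sq] using (hS s x hx).2
  refine ⟨f, ⟨fun x y => ?_, fun a x y => ?_, fun x y z => ?_, fun x hx => ?_⟩, 1, |D| + 1,
    one_pos, by positivity, hle⟩
  · refine tendsto_nhds_unique_of_eventuallyEq (hf x y) (hf y x) ?_
    filter_upwards [hq x y, hq y x] with s h1 h2
    rw [h1, h2]
    exact Finset.sum_congr rfl fun i _ => mul_comm _ _
  · refine tendsto_nhds_unique_of_eventuallyEq (hf (a • x) y) ((hf x y).const_mul a) ?_
    filter_upwards [hq (a • x) y, hq x y] with s h1 h2
    rw [h1, h2, map_smul, Finset.mul_sum]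
    exact Finset.sum_congr rfl fun i _ => by rw [Pi.smul_apply, smul_eq_mul, mul_assoc]
  · refine tendsto_nhds_unique_of_eventuallyEq (hf (x + y) z) ((hf x z).add (hf y z)) ?_
    filter_upwards [hq (x + y) z, hq x z, hq y z] with s h1 h2 h3
    rw [h1, h2, h3, map_add, ← Finset.sum_add_distrib]
    exact Finset.sum_congr rfl fun i _ => by rw [Pi.add_apply, add_mul]
  · have h1 := (hle x).1
    have h2 := norm_pos_iff.2 hx
    nlinarith [pow_pos h2 2]

lemma UniformlyComplemented.isomorphicToHilbert {c : ℝ}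
    (hY : UniformlyComplemented (normSeminorm ℝ Y) c) : IsomorphicToHilbert Y := by
  by_cases hfin : FiniteDimensional ℝ Y
  · obtain ⟨D, -, m, S, hS⟩ := exists_euclideanBound (E := (⊤ : Submodule ℝ Y))
      (Module.finite_def.1 hfin)
    exact isomorphicToHilbert_of_euclideanBound fun E _ => ⟨m, S, fun x _ => hS x trivial⟩
  have hc1 : UniformlyComplemented (normSeminorm ℝ Y) (max c 1) := fun E Z hE hZ hEZ => by
    obtain ⟨P, hP⟩ := hY E Z hE hZ hEZ
    exact ⟨P, fun z hz => ⟨(hP.1 z hz).1, (hP.1 z hz).2.trans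
      (mul_le_mul_of_nonneg_right (le_max_left c 1) (apply_nonneg _ z))⟩, hP.2⟩
  have hc : 0 < max c 1 := lt_max_of_lt_right one_pos
  obtain ⟨p, hp, hΛ⟩ := exists_isUnconditionalSpreading hfin hc.le hc1
  generalize max c 1 = c at *
  refine isomorphicToHilbert_of_euclideanBound fun E hE => EuclideanBound.of_improve hE
    (K := 2 * (4 * c) ^ 2 * (4 * (128 * (4 * c)) ^ 2 + (384 * 4 * (4 * c)) ^ 2)) (by positivity)
    fun D hD h => ?_
  exact h.improve hp (by positivity) hΛ (by positivity)
    (hp.exists_euclidean_map (by positivity) hΛ) hE hD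

end EuclideanForms

/-- Theorem 3.B.10: if for every closed subspace `M` of the real Banach space `X` the
quotient map `X → X/M` admits a Lipschitz right inverse on some net of `X/M`, then `X`
is isomorphic to a Hilbert space. -/
theorem lipschitz_right_inverse_on_net_implies_hilbert [CompleteSpace X]
    (h : ∀ (M : Submodule ℝ X) [IsClosed (M : Set X)],
      ∃ G : Set (X ⧸ M), IsNet G ∧
        ∃ (K : ℝ≥0) (ψ : G → X), LipschitzWith K ψ ∧
          ∀ u : G, Submodule.Quotient.mk (ψ u) = (u : X ⧸ M)) :
    IsomorphicToHilbert X := by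
  obtain ⟨c, hc⟩ := exists_uniformlyComplemented h
  exact hc.isomorphicToHilbert
end

section
/- Let X be a real Banach space and let 1 ≤ p ≤ 2 ≤ q < ∞. Suppose there exist measure spaces (Ω₁, μ₁) and (Ω₂, μ₂), continuous linear maps T : X → L^q(μ₁; ℝ) and S : X → L^p(μ₂; ℝ), and constants m₁, m₂ > 0 with ‖T(x)‖ ≥ m₁‖x‖ and ‖S(x)‖ ≥ m₂‖x‖ for all x ∈ X. Then X is isomorphic to a Hilbert space. -/
open MeasureTheory
open scoped ENNReal

universe u v w

variable (X : Type u) [NormedAddCommGroup X] [NormedSpace ℝ X]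

open scoped BigOperators

section Khintchine

variable {ι : Type*} [Fintype ι]

/-- The sign `±1` encoded by a Boolean. -/
def boolSign (b : Bool) : ℝ := cond b 1 (-1)

/-- Reduction to unit vectors: either `a = 0` or `a` is a positive multiple of a unit vector. -/
lemma eq_zero_or_exists_sum_div_sq_eq_one (a : ι → ℝ) :
    a = 0 ∨ ∃ σ : ℝ, 0 < σ ∧ ∑ i, (a i / σ) ^ 2 = 1 ∧
      ∀ r : ℝ, (∑ i, a i ^ 2) ^ (r / 2) = σ ^ r := by
  rcases (Finset.sum_nonneg fun i (_ : i ∈ Finset.univ) ↦ sq_nonneg (a i)).eq_or_lt with h | h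
  · left
    ext i
    simpa using (Finset.sum_eq_zero_iff_of_nonneg fun i _ ↦ sq_nonneg (a i)).1 h.symm i
  · refine .inr ⟨√(∑ i, a i ^ 2), Real.sqrt_pos.2 h, ?_, fun r ↦ ?_⟩
    · simp_rw [div_pow, Real.sq_sqrt h.le, ← Finset.sum_div, div_self h.ne']
    · rw [Real.sqrt_eq_rpow, ← Real.rpow_mul h.le, one_div_mul_eq_div]

variable [DecidableEq ι]

lemma expect_prod_bool (h : ι → Bool → ℝ) :
    𝔼 ε : ι → Bool, ∏ i, h i (ε i) = ∏ i, 𝔼 b, h i b := by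
  simp only [Fintype.expect_eq_sum_div_card, Finset.prod_div_distrib, Finset.prod_univ_sum,
    Fintype.piFinset_univ]
  simp

lemma expect_boolSign_mul_boolSign (i j : ι) :
    𝔼 ε : ι → Bool, boolSign (ε i) * boolSign (ε j) = if i = j then 1 else 0 := by
  split_ifs with hij
  · subst hij
    have : ∀ b, boolSign b * boolSign b = 1 := by intro b; cases b <;> simp [boolSign]
    simp [this]
  · have h := expect_prod_bool (ι := ι) fun k b ↦
      (if k = i then boolSign b else 1) * (if k = j then boolSign b else 1)
    simp only [Finset.prod_mul_distrib, Finset.prod_ite_eq', Finset.mem_univ, if_true] at h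
    rw [h]
    refine Finset.prod_eq_zero (Finset.mem_univ i) ?_
    rw [Fintype.expect_eq_sum_div_card]
    simp [hij, boolSign]

lemma expect_rademacher_sq (a : ι → ℝ) :
    𝔼 ε : ι → Bool, (∑ i, boolSign (ε i) * a i) ^ 2 = ∑ i, a i ^ 2 := by
  have h : ∀ ε : ι → Bool, (∑ i, boolSign (ε i) * a i) ^ 2
      = ∑ i, ∑ j, boolSign (ε i) * boolSign (ε j) * (a i * a j) := by
    intro ε
    rw [sq, Finset.sum_mul_sum]
    exact Finset.sum_congr rfl fun i _ ↦ Finset.sum_congr rfl fun j _ ↦ by ring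
  simp_rw [h, Finset.expect_sum_comm, ← Finset.expect_mul, expect_boolSign_mul_boolSign]
  simp [sq]

lemma expect_exp_rademacher_le (a : ι → ℝ) :
    𝔼 ε : ι → Bool, Real.exp (∑ i, boolSign (ε i) * a i) ≤ Real.exp ((∑ i, a i ^ 2) / 2) := by
  simp_rw [Real.exp_sum]
  rw [expect_prod_bool fun i b ↦ Real.exp (boolSign b * a i), Finset.sum_div, Real.exp_sum]
  refine Finset.prod_le_prod (fun i _ ↦ ?_) fun i _ ↦ ?_
  · exact Finset.expect_nonneg fun _ _ ↦ (Real.exp_pos _).le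
  · refine Eq.trans_le ?_ (Real.cosh_le_exp_half_sq (a i))
    rw [Fintype.expect_eq_sum_div_card]
    simp [boolSign, Real.cosh_eq]

lemma abs_rpow_le_mul_exp {r : ℝ} (hr : 0 < r) (t : ℝ) :
    |t| ^ r ≤ r ^ r * (Real.exp t + Real.exp (-t)) := by
  have h1 : |t| / r ≤ Real.exp (|t| / r) := by linarith [Real.add_one_le_exp (|t| / r)]
  have h2 : (|t| / r) ^ r ≤ Real.exp |t| := by
    refine (Real.rpow_le_rpow (by positivity) h1 hr.le).trans_eq ?_
    rw [← Real.exp_mul, div_mul_cancel₀ _ hr.ne']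
  rw [Real.div_rpow (abs_nonneg t) hr.le, div_le_iff₀' (by positivity)] at h2
  exact h2.trans (by gcongr; exact Real.exp_abs_le t)

lemma expect_abs_rademacher_rpow_le_of_sum_sq_eq_one {r : ℝ} (hr : 0 < r) {a : ι → ℝ}
    (ha : ∑ i, a i ^ 2 = 1) :
    𝔼 ε : ι → Bool, |∑ i, boolSign (ε i) * a i| ^ r ≤ r ^ r * (2 * Real.exp (1 / 2)) := by
  have h1 := expect_exp_rademacher_le a
  have h2 := expect_exp_rademacher_le fun i ↦ -a i
  simp only [mul_neg, Finset.sum_neg_distrib, neg_sq, ha] at h1 h2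
  calc _ ≤ 𝔼 ε : ι → Bool, r ^ r * (Real.exp (∑ i, boolSign (ε i) * a i)
          + Real.exp (-∑ i, boolSign (ε i) * a i)) :=
        Finset.expect_le_expect fun ε _ ↦ abs_rpow_le_mul_exp hr _
    _ ≤ _ := by
        rw [← Finset.mul_expect, Finset.expect_add_distrib]
        gcongr
        linarith

lemma one_le_mul_expect_abs_rademacher_rpow {p : ℝ} (hp : 0 < p) (hp2 : p ≤ 2) {a : ι → ℝ}
    (ha : ∑ i, a i ^ 2 = 1) :
    1 ≤ 4 * (4 ^ 4 * (2 * Real.exp (1 / 2))) *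
      𝔼 ε : ι → Bool, |∑ i, boolSign (ε i) * a i| ^ p := by
  have h2 := expect_rademacher_sq a
  have h4 := expect_abs_rademacher_rpow_le_of_sum_sq_eq_one (r := 4) (by norm_num) ha
  set B : ℝ := 4 ^ 4 * (2 * Real.exp (1 / 2)) with hB
  have hB1 : 1 ≤ 2 * B := by
    have := Real.add_one_le_exp (1 / 2 : ℝ)
    rw [hB]; linarith
  have hpt : ∀ x : ℝ, x ^ 2 ≤ 2 * B * |x| ^ p + |x| ^ (4 : ℝ) / (2 * B) := by
    intro x
    have e4 : |x| ^ (4 : ℝ) = (x ^ 2) ^ 2 := by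
      rw [← sq_abs x, ← pow_mul, ← Real.rpow_natCast]; norm_num
    have hxp : 0 ≤ |x| ^ p := by positivity
    rw [e4]
    rcases le_total (x ^ 2) (2 * B) with h | h
    · refine le_add_of_le_of_nonneg ?_ (by positivity)
      rcases le_total |x| 1 with hx | hx
      · have : x ^ 2 ≤ |x| ^ p := by
          rw [← sq_abs x, ← Real.rpow_two]
          rcases (abs_nonneg x).eq_or_lt with h0 | h0
          · simp [← h0, hp.ne']
          · exact Real.rpow_le_rpow_of_exponent_ge h0 hx hp2
        nlinarith
      · nlinarith [Real.one_le_rpow hx hp.le]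
    · refine le_add_of_nonneg_of_le (by positivity) ?_
      rw [le_div_iff₀ (by positivity)]
      nlinarith [sq_nonneg x]
  have h := Finset.expect_le_expect (s := (Finset.univ : Finset (ι → Bool)))
    fun ε _ ↦ hpt (∑ i, boolSign (ε i) * a i)
  rw [h2, ha, Finset.expect_add_distrib, ← Finset.mul_expect, ← Finset.expect_div] at h
  have h5 : (𝔼 ε : ι → Bool, |∑ i, boolSign (ε i) * a i| ^ (4 : ℝ)) / (2 * B) ≤ 1 / 2 := by
    rw [div_le_iff₀ (by positivity)]
    norm_num at h4 ⊢
    linarith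
  linarith

lemma expect_abs_rademacher_rpow_eq_mul (r : ℝ) (a : ι → ℝ) {σ : ℝ} (hσ : 0 < σ) :
    𝔼 ε : ι → Bool, |∑ i, boolSign (ε i) * a i| ^ r
      = σ ^ r * 𝔼 ε : ι → Bool, |∑ i, boolSign (ε i) * (a i / σ)| ^ r := by
  simp_rw [← mul_div_assoc, ← Finset.sum_div, Finset.mul_expect]
  refine Finset.expect_congr rfl fun ε _ ↦ ?_
  rw [← Real.mul_rpow hσ.le (abs_nonneg _), abs_div, abs_of_pos hσ, mul_div_cancel₀ _ hσ.ne']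

/-- The upper Khintchine inequality. -/
lemma expect_abs_rademacher_rpow_le {r : ℝ} (hr : 0 < r) (a : ι → ℝ) :
    𝔼 ε : ι → Bool, |∑ i, boolSign (ε i) * a i| ^ r
      ≤ r ^ r * (2 * Real.exp (1 / 2)) * (∑ i, a i ^ 2) ^ (r / 2) := by
  obtain rfl | ⟨σ, hσ, h1, h2⟩ := eq_zero_or_exists_sum_div_sq_eq_one a
  · simp [hr.ne']
  · rw [h2, expect_abs_rademacher_rpow_eq_mul r a hσ, mul_comm]
    gcongr
    exact expect_abs_rademacher_rpow_le_of_sum_sq_eq_one hr h1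

/-- The lower Khintchine inequality. -/
lemma sum_sq_rpow_le_mul_expect_abs_rademacher_rpow {p : ℝ} (hp : 0 < p) (hp2 : p ≤ 2)
    (a : ι → ℝ) :
    (∑ i, a i ^ 2) ^ (p / 2) ≤ 4 * (4 ^ 4 * (2 * Real.exp (1 / 2))) *
      𝔼 ε : ι → Bool, |∑ i, boolSign (ε i) * a i| ^ p := by
  obtain rfl | ⟨σ, hσ, h1, h2⟩ := eq_zero_or_exists_sum_div_sq_eq_one a
  · simp [hp.ne']
  · rw [h2, expect_abs_rademacher_rpow_eq_mul p a hσ, mul_left_comm]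
    exact le_mul_of_one_le_right (by positivity)
      (one_le_mul_expect_abs_rademacher_rpow hp hp2 h1)

end Khintchine

section LpSquareFunction

variable {Ω : Type*} {m : MeasurableSpace Ω} {μ : Measure Ω} {p q : ℝ≥0∞}

lemma Lp_norm_rpow_toReal (hp0 : p ≠ 0) (hp : p ≠ ∞) (f : Lp ℝ p μ) :
    ‖f‖ ^ p.toReal = ∫ ω, |f ω| ^ p.toReal ∂μ := by
  have h0 : 0 ≤ ∫ ω, ‖f ω‖ ^ p.toReal ∂μ := integral_nonneg fun _ ↦ by positivity
  rw [Lp.norm_def, (Lp.memLp f).eLpNorm_eq_integral_rpow_norm hp0 hp,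
    ENNReal.toReal_ofReal (by positivity),
    Real.rpow_inv_rpow h0 (ENNReal.toReal_ne_zero.2 ⟨hp0, hp⟩)]
  rfl

variable {ι : Type*} [Fintype ι]

lemma coeFn_sum_boolSign_smul (f : ι → Lp ℝ p μ) (ε : ι → Bool) :
    (∑ i, boolSign (ε i) • f i : Lp ℝ p μ) =ᵐ[μ] fun ω ↦ ∑ i, boolSign (ε i) * f i ω := by
  filter_upwards [Lp.coeFn_finsetSum Finset.univ fun i ↦ boolSign (ε i) • f i,
    ae_all_iff.2 fun i ↦ Lp.coeFn_smul (boolSign (ε i)) (f i)] with ω h1 h2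
  rw [h1, Finset.sum_apply]
  simp [h2]

lemma integrable_abs_rademacher_rpow (hp0 : p ≠ 0) (hp : p ≠ ∞) (f : ι → Lp ℝ p μ)
    (ε : ι → Bool) :
    Integrable (fun ω ↦ |∑ i, boolSign (ε i) * f i ω| ^ p.toReal) μ := by
  refine ((Lp.memLp (∑ i, boolSign (ε i) • f i)).integrable_norm_rpow hp0 hp).congr ?_
  filter_upwards [coeFn_sum_boolSign_smul f ε] with ω h
  rw [h, Real.norm_eq_abs]

/-- For `p ≤ 2`, `L^p` is `2`-concave. -/
lemma sum_norm_sq_rpow_le_integral (hp0 : p ≠ 0) (hp2 : p ≤ 2) (g : ι → Lp ℝ p μ) :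
    Integrable (fun ω ↦ (∑ i, g i ω ^ 2) ^ (p.toReal / 2)) μ ∧
    (∑ i, ‖g i‖ ^ 2) ^ (p.toReal / 2) ≤ ∫ ω, (∑ i, g i ω ^ 2) ^ (p.toReal / 2) ∂μ := by
  have hp : p ≠ ∞ := (hp2.trans_lt (by norm_num)).ne
  have hpos : 0 < p.toReal := ENNReal.toReal_pos hp0 hp
  have hs : (2 / p).toReal = 2 / p.toReal := by simp
  have hs0 : 0 < (2 / p).toReal := by rw [hs]; positivity
  have : Fact (1 ≤ 2 / p) := ⟨by rwa [ENNReal.le_div_iff_mul_le (.inl hp0) (.inl hp), one_mul]⟩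
  have hn : ∀ a : ι → ℝ,
      ‖(WithLp.toLp (2 / p) fun i ↦ |a i| ^ p.toReal : PiLp (2 / p) fun _ : ι ↦ ℝ)‖
      = (∑ i, a i ^ 2) ^ (p.toReal / 2) := by
    intro a
    rw [PiLp.norm_eq_sum hs0, hs, one_div_div]
    congr 1
    refine Finset.sum_congr rfl fun i _ ↦ ?_
    rw [Real.norm_eq_abs, abs_of_nonneg (by positivity), ← Real.rpow_mul (abs_nonneg _),
      mul_div_cancel₀ _ hpos.ne', Real.rpow_two, sq_abs]
  let G : Ω → PiLp (2 / p) fun _ : ι ↦ ℝ := fun ω ↦ WithLp.toLp (2 / p) fun i ↦ |g i ω| ^ p.toReal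
  have hGi : ∀ i, Integrable (fun ω ↦ G ω i) μ := fun i ↦
    (Lp.memLp (g i)).integrable_norm_rpow hp0 hp
  have hG : Integrable G μ := integrable_piLp_iff.2 hGi
  have hint : ∫ ω, G ω ∂μ = WithLp.toLp (2 / p) fun i ↦ |‖g i‖| ^ p.toReal := by
    ext i
    rw [eval_integral_piLp hGi]
    change _ = |‖g i‖| ^ p.toReal
    have h0 : 0 ≤ ‖g i‖ := by rw [Lp.norm_def]; exact ENNReal.toReal_nonneg
    rw [abs_of_nonneg h0, Lp_norm_rpow_toReal hp0 hp]
  have hle := norm_integral_le_integral_norm (μ := μ) G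
  rw [hint, hn] at hle
  simp only [G, hn] at hle
  exact ⟨hG.norm.congr (.of_forall fun ω ↦ hn _), hle⟩

variable [DecidableEq ι]

lemma integrable_expect_abs_rademacher_rpow (hp0 : p ≠ 0) (hp : p ≠ ∞) (f : ι → Lp ℝ p μ) :
    Integrable (fun ω ↦ 𝔼 ε : ι → Bool, |∑ i, boolSign (ε i) * f i ω| ^ p.toReal) μ := by
  simp_rw [Fintype.expect_eq_sum_div_card]
  exact (integrable_finsetSum _ fun ε _ ↦ integrable_abs_rademacher_rpow hp0 hp f ε).div_const _

lemma expect_norm_rademacher_rpow (hp0 : p ≠ 0) (hp : p ≠ ∞) (f : ι → Lp ℝ p μ) :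
    𝔼 ε : ι → Bool, ‖∑ i, boolSign (ε i) • f i‖ ^ p.toReal
      = ∫ ω, 𝔼 ε : ι → Bool, |∑ i, boolSign (ε i) * f i ω| ^ p.toReal ∂μ := by
  simp_rw [Fintype.expect_eq_sum_div_card]
  rw [integral_div, integral_finsetSum _ fun ε _ ↦ integrable_abs_rademacher_rpow hp0 hp f ε]
  congr 1
  refine Finset.sum_congr rfl fun ε _ ↦ ?_
  rw [Lp_norm_rpow_toReal hp0 hp]
  refine integral_congr_ae ?_
  filter_upwards [coeFn_sum_boolSign_smul f ε] with ω h
  rw [h]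

/-- The Rademacher averages in `L^q` are controlled by the square function. -/
lemma expect_norm_rademacher_rpow_le (hq0 : q ≠ 0) (hq : q ≠ ∞) (f : ι → Lp ℝ q μ)
    (h : Lp ℝ (q / 2) μ) (hh : h =ᵐ[μ] fun ω ↦ ∑ i, f i ω ^ 2) :
    𝔼 ε : ι → Bool, ‖∑ i, boolSign (ε i) • f i‖ ^ q.toReal
      ≤ q.toReal ^ q.toReal * (2 * Real.exp (1 / 2)) * ‖h‖ ^ (q.toReal / 2) := by
  have h20 : q / 2 ≠ 0 := ENNReal.div_ne_zero.2 ⟨hq0, by norm_num⟩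
  have h2 : q / 2 ≠ ∞ := ENNReal.div_ne_top hq (by norm_num)
  have e2 : (q / 2).toReal = q.toReal / 2 := by simp
  rw [expect_norm_rademacher_rpow hq0 hq, ← e2, Lp_norm_rpow_toReal h20 h2,
    ← integral_const_mul]
  refine integral_mono_ae (integrable_expect_abs_rademacher_rpow hq0 hq f)
    (((Lp.memLp h).integrable_norm_rpow h20 h2).const_mul _) ?_
  filter_upwards [hh] with ω hω
  rw [e2, hω, abs_of_nonneg (Finset.sum_nonneg fun i _ ↦ sq_nonneg _)]
  exact expect_abs_rademacher_rpow_le (ENNReal.toReal_pos hq0 hq) _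

/-- For `p ≤ 2`, `L^p` has cotype `2`. -/
lemma sum_norm_sq_rpow_le_expect (hp0 : p ≠ 0) (hp2 : p ≤ 2) (g : ι → Lp ℝ p μ) :
    (∑ i, ‖g i‖ ^ 2) ^ (p.toReal / 2) ≤ 4 * (4 ^ 4 * (2 * Real.exp (1 / 2))) *
      𝔼 ε : ι → Bool, ‖∑ i, boolSign (ε i) • g i‖ ^ p.toReal := by
  have hp : p ≠ ∞ := (hp2.trans_lt (by norm_num)).ne
  obtain ⟨h1, h2⟩ := sum_norm_sq_rpow_le_integral hp0 hp2 g
  refine h2.trans ?_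
  rw [expect_norm_rademacher_rpow hp0 hp, ← integral_const_mul]
  refine integral_mono h1 ((integrable_expect_abs_rademacher_rpow hp0 hp g).const_mul _) fun ω ↦ ?_
  refine sum_sq_rpow_le_mul_expect_abs_rademacher_rpow (ENNReal.toReal_pos hp0 hp) ?_ _
  simpa using ENNReal.toReal_mono (by norm_num) hp2

end LpSquareFunction

section Embeddings

variable {X : Type*} [NormedAddCommGroup X] [NormedSpace ℝ X] {p q : ℝ≥0∞}
  [Fact (1 ≤ p)] [Fact (1 ≤ q)]
  {Ω₁ : Type*} {m₁ : MeasurableSpace Ω₁} {μ₁ : Measure Ω₁}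
  {Ω₂ : Type*} {m₂ : MeasurableSpace Ω₂} {μ₂ : Measure Ω₂}

lemma expect_rpow_le_expect_rpow {κ : Type*} [Fintype κ] [Nonempty κ] {z : κ → ℝ}
    (hz : ∀ k, 0 ≤ z k) {r s : ℝ} (hr : 0 < r) (hrs : r ≤ s) :
    𝔼 k, z k ^ r ≤ (𝔼 k, z k ^ s) ^ (r / s) := by
  have h := Real.arith_mean_le_rpow_mean (Finset.univ : Finset κ)
    (fun _ ↦ (Fintype.card κ : ℝ)⁻¹) (fun k ↦ z k ^ r) (fun _ _ ↦ by positivity)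
    (by simp) (fun k _ ↦ Real.rpow_nonneg (hz k) r) ((one_le_div hr).2 hrs)
  simp_rw [← Real.rpow_mul (hz _), mul_div_cancel₀ _ hr.ne', one_div_div, ← Finset.mul_sum] at h
  simpa only [Fintype.expect_eq_sum_div_card, div_eq_inv_mul] using h

lemma exists_sum_norm_sq_le_mul_norm [Fact (1 ≤ q / 2)] (hp2 : p ≤ 2) (hq2 : 2 ≤ q) (hq : q ≠ ∞)
    (T : X →L[ℝ] Lp ℝ q μ₁) {c₁ : ℝ} (hc₁ : 0 < c₁) (hT : ∀ x, c₁ * ‖x‖ ≤ ‖T x‖)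
    (S : X →L[ℝ] Lp ℝ p μ₂) {c₂ : ℝ} (hc₂ : 0 < c₂) (hS : ∀ x, c₂ * ‖x‖ ≤ ‖S x‖) :
    ∃ C : ℝ, 0 < C ∧ ∀ (ι : Type*) [Fintype ι] (x : ι → X) (h : Lp ℝ (q / 2) μ₁),
      (h =ᵐ[μ₁] fun ω ↦ ∑ i, T (x i) ω ^ 2) → ∑ i, ‖x i‖ ^ 2 ≤ C * ‖h‖ := by
  have hp0 : p ≠ 0 := (zero_lt_one.trans_le (Fact.out : 1 ≤ p)).ne'
  have hq0 : q ≠ 0 := (zero_lt_one.trans_le (Fact.out : 1 ≤ q)).ne'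
  have hp : p ≠ ∞ := (hp2.trans_lt (by norm_num)).ne
  have hP : 0 < p.toReal := ENNReal.toReal_pos hp0 hp
  have hQ : 0 < q.toReal := ENNReal.toReal_pos hq0 hq
  have hPQ : p.toReal ≤ q.toReal := ENNReal.toReal_mono hq (hp2.trans hq2)
  set P := p.toReal
  set Q := q.toReal
  set A : ℝ := 4 * (4 ^ 4 * (2 * Real.exp (1 / 2)))
  set B : ℝ := Q ^ Q * (2 * Real.exp (1 / 2))
  have hA : 0 < A := by positivity
  have hB : 0 < B := by positivity
  set D : ℝ := A * ‖S‖ ^ P * (B / c₁ ^ Q) ^ (P / Q) / c₂ ^ P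
  have hD : 0 ≤ D := by positivity
  refine ⟨D ^ (2 / P) + 1, by positivity, fun ι _ x h hh ↦ ?_⟩
  classical
  have hup := expect_norm_rademacher_rpow_le hq0 hq (fun i ↦ T (x i)) h hh
  have hlow := sum_norm_sq_rpow_le_expect hp0 hp2 fun i ↦ S (x i)
  simp_rw [← map_smul, ← map_sum] at hup hlow
  set y : (ι → Bool) → X := fun ε ↦ ∑ i, boolSign (ε i) • x i
  have hupX : 𝔼 ε, ‖y ε‖ ^ Q ≤ B / c₁ ^ Q * ‖h‖ ^ (Q / 2) := by
    rw [div_mul_eq_mul_div, le_div_iff₀' (by positivity), Finset.mul_expect]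
    refine (Finset.expect_le_expect fun ε _ ↦ ?_).trans hup
    rw [← Real.mul_rpow hc₁.le (norm_nonneg _)]
    gcongr
    exact hT _
  have hlowX : 𝔼 ε, ‖S (y ε)‖ ^ P ≤ ‖S‖ ^ P * 𝔼 ε, ‖y ε‖ ^ P := by
    rw [Finset.mul_expect]
    refine Finset.expect_le_expect fun ε _ ↦ ?_
    rw [← Real.mul_rpow (norm_nonneg _) (norm_nonneg _)]
    gcongr
    exact S.le_opNorm _
  have hN : c₂ ^ P * (∑ i, ‖x i‖ ^ 2) ^ (P / 2) ≤ (∑ i, ‖S (x i)‖ ^ 2) ^ (P / 2) := by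
    have e : c₂ ^ P = (c₂ ^ 2) ^ (P / 2) := by
      rw [← Real.rpow_natCast, ← Real.rpow_mul hc₂.le]; congr 1; push_cast; ring
    rw [e, ← Real.mul_rpow (by positivity) (by positivity), Finset.mul_sum]
    gcongr with i
    rw [← mul_pow]
    gcongr
    exact hS _
  have key : (∑ i, ‖x i‖ ^ 2) ^ (P / 2) ≤ D * ‖h‖ ^ (P / 2) := by
    rw [div_mul_eq_mul_div, le_div_iff₀' (by positivity)]
    calc _ ≤ A * 𝔼 ε, ‖S (y ε)‖ ^ P := hN.trans hlow
      _ ≤ A * (‖S‖ ^ P * (𝔼 ε, ‖y ε‖ ^ Q) ^ (P / Q)) := by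
        gcongr
        refine hlowX.trans ?_
        gcongr
        exact expect_rpow_le_expect_rpow (fun _ ↦ norm_nonneg _) hP hPQ
      _ ≤ A * (‖S‖ ^ P * (B / c₁ ^ Q * ‖h‖ ^ (Q / 2)) ^ (P / Q)) := by
        gcongr
      _ = _ := by
        rw [Real.mul_rpow (by positivity) (by positivity), ← Real.rpow_mul (norm_nonneg _),
          show Q / 2 * (P / Q) = P / 2 by field_simp]
        ring
  have := Real.rpow_le_rpow (by positivity) key (by positivity : 0 ≤ 2 / P)
  rw [Real.mul_rpow hD (by positivity), ← Real.rpow_mul (by positivity),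
    ← Real.rpow_mul (by positivity), show P / 2 * (2 / P) = 1 by field_simp, Real.rpow_one,
    Real.rpow_one] at this
  linarith [norm_nonneg h]

end Embeddings

section Separation

variable {X : Type*} [NormedAddCommGroup X] [NormedSpace ℝ X]
  {E : Type*} [NormedAddCommGroup E] [NormedSpace ℝ E]

/-- If a vector-valued bilinear map satisfies `∑ ‖x i‖² ≤ C ‖∑ Φ (x i) (x i)‖`, then the
Hahn-Banach theorem yields a functional which turns it into a coercive bilinear form. -/
lemma exists_dual_coercive (Φ : X →L[ℝ] X →L[ℝ] E) {C : ℝ} (hC : 0 < C)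
    (h : ∀ (ι : Type) [Fintype ι] (x : ι → X), ∑ i, ‖x i‖ ^ 2 ≤ C * ‖∑ i, Φ (x i) (x i)‖) :
    ∃ (Λ : E →L[ℝ] ℝ) (u : ℝ), 0 < u ∧ ∀ x, u * ‖x‖ ^ 2 ≤ Λ (Φ x x) := by
  set K : Set E := convexHull ℝ ((fun x ↦ Φ x x) '' Metric.sphere 0 1)
  have hK : Disjoint (Metric.ball (0 : E) C⁻¹) K := by
    refine Set.disjoint_left.2 fun e he heK ↦ ?_
    obtain ⟨ι, _, w, z, hw, hw1, hz, rfl⟩ := mem_convexHull_iff_exists_fintype.1 heK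
    choose x hx hxz using hz
    have := h ι fun i ↦ √(w i) • x i
    simp only [norm_smul, mem_sphere_zero_iff_norm.1 (hx _), map_smul, smul_apply,
      smul_smul, Real.norm_eq_abs, sq_abs, Real.sq_sqrt (hw _), Real.mul_self_sqrt (hw _),
      mul_one, hw1, hxz] at this
    rw [mem_ball_zero_iff, ← one_div, lt_div_iff₀' hC] at he
    linarith
  obtain ⟨Λ, u, hball, hu⟩ := geometric_hahn_banach_open (convex_ball _ _) Metric.isOpen_ball
    (convex_convexHull ℝ _) hK
  have hu0 : 0 < u := by simpa using hball 0 (Metric.mem_ball_self (inv_pos.2 hC))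
  refine ⟨Λ, u, hu0, fun x ↦ ?_⟩
  rcases eq_or_ne x 0 with rfl | hx
  · simp
  · have hn : 0 < ‖x‖ := norm_pos_iff.2 hx
    have := hu _ (subset_convexHull ℝ _ ⟨‖x‖⁻¹ • x, by simp [norm_smul, hn.ne'], rfl⟩)
    simp only [map_smul, smul_apply, smul_eq_mul] at this
    calc u * ‖x‖ ^ 2 ≤ (‖x‖⁻¹ * (‖x‖⁻¹ * Λ (Φ x x))) * ‖x‖ ^ 2 := by gcongr
      _ = _ := by field_simp

end Separation

/-- Theorem 3.C.2 (Kwapień): if a real Banach space `X` linearly embeds into an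
`L^q`-space and into an `L^p`-space, where `1 ≤ p ≤ 2 ≤ q < ∞`, then `X` is isomorphic
to a Hilbert space. -/
theorem embeds_in_Lq_and_Lp_implies_hilbert [CompleteSpace X]
    (p q : ℝ≥0∞) [Fact (1 ≤ p)] [Fact (1 ≤ q)] (hp2 : p ≤ 2) (hq2 : 2 ≤ q) (hq : q < ∞)
    (hT : ∃ (Ω₁ : Type v) (m₁ : MeasurableSpace Ω₁) (μ₁ : @Measure Ω₁ m₁)
      (T : X →L[ℝ] Lp ℝ q μ₁) (c₁ : ℝ), 0 < c₁ ∧ ∀ x : X, c₁ * ‖x‖ ≤ ‖T x‖)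
    (hS : ∃ (Ω₂ : Type w) (m₂ : MeasurableSpace Ω₂) (μ₂ : @Measure Ω₂ m₂)
      (S : X →L[ℝ] Lp ℝ p μ₂) (c₂ : ℝ), 0 < c₂ ∧ ∀ x : X, c₂ * ‖x‖ ≤ ‖S x‖) :
    IsomorphicToHilbert X := by
  obtain ⟨Ω₁, m₁, μ₁, T, c₁, hc₁, hT⟩ := hT
  obtain ⟨Ω₂, m₂, μ₂, S, c₂, hc₂, hS⟩ := hS
  have : Fact (1 ≤ q / 2) :=
    ⟨by rwa [ENNReal.le_div_iff_mul_le (.inl two_ne_zero) (.inl ENNReal.ofNat_ne_top), one_mul]⟩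
  have : ENNReal.HolderTriple q q (q / 2) :=
    ⟨by rw [ENNReal.inv_div (.inl ENNReal.ofNat_ne_top) (.inl two_ne_zero), ← two_mul,
      ENNReal.div_eq_inv_mul, mul_comm]⟩
  let M := (ContinuousLinearMap.mul ℝ ℝ).holderL μ₁ q q (q / 2)
  have hM : ∀ f g, M f g =ᵐ[μ₁] fun ω ↦ f ω * g ω :=
    (ContinuousLinearMap.mul ℝ ℝ).coeFn_holder
  let Φ : X →L[ℝ] X →L[ℝ] Lp ℝ (q / 2) μ₁ := M.bilinearComp T T
  have hΦ : ∀ x y, Φ x y = M (T x) (T y) := fun _ _ ↦ rfl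
  have hΦs : ∀ x y, Φ x y = Φ y x := by
    intro x y
    refine Lp.ext ?_
    filter_upwards [hM (T x) (T y), hM (T y) (T x)] with ω h1 h2
    rw [hΦ, hΦ, h1, h2, mul_comm]
  obtain ⟨C, hC, hCx⟩ := exists_sum_norm_sq_le_mul_norm hp2 hq2 hq.ne T hc₁ hT S hc₂ hS
  obtain ⟨Λ, u, hu, hΛ⟩ := exists_dual_coercive Φ hC fun ι _ x ↦ hCx ι x _ <| by
    filter_upwards [Lp.coeFn_finsetSum Finset.univ fun i ↦ Φ (x i) (x i),
      ae_all_iff.2 fun i ↦ hM (T (x i)) (T (x i))] with ω h1 h2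
    rw [h1, Finset.sum_apply]
    exact Finset.sum_congr rfl fun i _ ↦ by rw [hΦ, h2, sq]
  refine ⟨fun x y ↦ Λ (Φ x y), ⟨fun x y ↦ congrArg Λ (hΦs x y), fun a x y ↦ by simp,
    fun x y z ↦ by simp, fun x hx ↦ (by positivity : 0 < u * ‖x‖ ^ 2).trans_le (hΛ x)⟩, u, ‖Λ‖ * ‖Φ‖ + 1, hu,
    by positivity, fun x ↦ ⟨hΛ x, ?_⟩⟩
  calc Λ (Φ x x) ≤ ‖Λ‖ * ‖Φ x x‖ := (le_abs_self _).trans (Λ.le_opNorm _)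
    _ ≤ ‖Λ‖ * (‖Φ‖ * ‖x‖ * ‖x‖) := by gcongr; exact Φ.le_opNorm₂ x x
    _ ≤ (‖Λ‖ * ‖Φ‖ + 1) * ‖x‖ ^ 2 := by nlinarith [sq_nonneg ‖x‖]
end
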